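/- arXiv:1511.03991 — 2 statements merged into one kernel-verified Lean document; each statement's English description precedes it below -/
import Mathlib

section
/- Let M and N be finitely generated R-modules and let J ⊆ I be an ideal generated by a Q-regular sequence whose images in V are k-linearly independent. Then Ext^i_{Q/J}(M,N) ≠ 0 for infinitely many i if and only if Ext^i_{Q/J}(N,M) ≠ 0 for infinitely many i. (Equivalently, the higher-order support varieties satisfy V_R^d(M,N) = V_R^d(N,M).) -/
open CategoryTheory IsLocalRing

/-- A local ring is regular if its maximal ideal can be generated by a regular sequence. -/
def IsRegularLocal (Q : Type) [CommRing Q] [IsLocalRing Q] : Prop :=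
  ∃ rs : List Q, RingTheory.Sequence.IsRegular Q rs ∧
    Ideal.span {x | x ∈ rs} = maximalIdeal Q

theorem Module.IsTorsionBySet.mono' {Q M : Type} [CommRing Q] [AddCommGroup M] [Module Q M]
    {J I : Ideal Q} (h : Module.IsTorsionBySet Q M (I : Set Q)) (hJI : J ≤ I) :
    Module.IsTorsionBySet Q M (J : Set Q) := fun x a => @h x ⟨a.1, hJI a.2⟩

/-- The `Q ⧸ J`-module structure on a module annihilated by `I ⊇ J`. -/
def modOver {Q : Type} [CommRing Q] {I : Ideal Q} (J : Ideal Q) (hJI : J ≤ I)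
    (M : Type) [AddCommGroup M] [Module Q M]
    (hM : Module.IsTorsionBySet Q M (I : Set Q)) : Module (Q ⧸ J) M :=
  (hM.mono' hJI).module

theorem quot_isTorsionBySet (Q : Type) [CommRing Q] (J : Ideal Q) :
    Module.IsTorsionBySet Q (Q ⧸ J) (J : Set Q) := fun x a => by
  induction x using Quotient.inductionOn with
  | h q =>
    show ((a : Q) • Submodule.Quotient.mk q : Q ⧸ J) = 0
    rw [← Submodule.Quotient.mk_smul, Submodule.Quotient.mk_eq_zero, smul_eq_mul]
    exact Ideal.mul_mem_right q J a.2

/-- The residue field `k = Q/𝔪` as a module over `Q ⧸ J` for any `J ≤ 𝔪`. -/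
def kMod {Q : Type} [CommRing Q] [IsLocalRing Q] (J : Ideal Q) (hJm : J ≤ maximalIdeal Q) :
    Module (Q ⧸ J) (Q ⧸ maximalIdeal Q) :=
  modOver J hJm (Q ⧸ maximalIdeal Q) (quot_isTorsionBySet Q (maximalIdeal Q))

/-- `Ext^i_A(M, N)`, as a module over `A`, for explicitly given module structures. -/
noncomputable def extMod (A : Type) [CommRing A] (M N : Type) [AddCommGroup M] [AddCommGroup N]
    (mM : Module A M) (mN : Module A N) (i : ℕ) : ModuleCat A :=
  ((Ext A (ModuleCat A) i).obj (Opposite.op (@ModuleCat.of A _ M _ mM))).obj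
    (@ModuleCat.of A _ N _ mN)

/-- `Ext^i_A(M, N) ≠ 0` for infinitely many `i`. -/
def extInf (A : Type) [CommRing A] (M N : Type) [AddCommGroup M] [AddCommGroup N]
    (mM : Module A M) (mN : Module A N) : Prop :=
  ∀ n : ℕ, ∃ i, n ≤ i ∧ Nontrivial (extMod A M N mM mN i)

/-- `Ext^i_A(M, N) = 0` for all `i ≫ 0`. -/
def extVan (A : Type) [CommRing A] (M N : Type) [AddCommGroup M] [AddCommGroup N]
    (mM : Module A M) (mN : Module A N) : Prop :=
  ∃ n₀ : ℕ, ∀ i, n₀ ≤ i → Subsingleton (extMod A M N mM mN i)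

/-- The images in `V = I/𝔫I` of the elements `g i` of `I` are `k`-linearly independent. -/
def LinIndepInV (Q : Type) [CommRing Q] [IsLocalRing Q] (I : Ideal Q)
    {d : ℕ} (g : Fin d → Q) : Prop :=
  (∀ i, g i ∈ I) ∧
    ∀ a : Fin d → Q, (∑ i, a i * g i) ∈ maximalIdeal Q * I → ∀ i, a i ∈ maximalIdeal Q

/-- The depth of a module over a local ring: the supremum of the lengths of
regular sequences on the module consisting of elements of the maximal ideal. -/
noncomputable def localDepth (Q : Type) [CommRing Q] [IsLocalRing Q]
    (M : Type) [AddCommGroup M] [Module Q M] : ℕ :=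
  sSup {n | ∃ rs : List Q, rs.length = n ∧ (∀ r ∈ rs, r ∈ maximalIdeal Q) ∧
    RingTheory.Sequence.IsRegular M rs}


section EVBasics

open CategoryTheory.Abelian

/-- Vanishing of `Ext^i_A(X, Y)`. -/
def EV (A : Type) [CommRing A] (X Y : Type) [AddCommGroup X] [Module A X]
    [AddCommGroup Y] [Module A Y] (i : ℕ) : Prop :=
  Subsingleton (Abelian.Ext (ModuleCat.of A X) (ModuleCat.of A Y) i)

variable {A : Type} [CommRing A]
variable {X Y Z W : Type} [AddCommGroup X] [Module A X] [AddCommGroup Y] [Module A Y]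
  [AddCommGroup Z] [Module A Z] [AddCommGroup W] [Module A W]

/-- Short exact sequences of modules. -/
structure SES (f : X →ₗ[A] Y) (g : Y →ₗ[A] Z) : Prop where
  inj : Function.Injective f
  surj : Function.Surjective g
  exact : Function.Exact f g

theorem SES.zero {f : X →ₗ[A] Y} {g : Y →ₗ[A] Z} (h : SES f g) :
    ModuleCat.ofHom f ≫ ModuleCat.ofHom g = 0 := by
  ext x
  exact h.exact.apply_apply_eq_zero x

theorem SES.shortExact {f : X →ₗ[A] Y} {g : Y →ₗ[A] Z} (h : SES f g) :
    (ShortComplex.mk (ModuleCat.ofHom f) (ModuleCat.ofHom g) h.zero).ShortExact where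
  exact := by
    rw [ShortComplex.ShortExact.moduleCat_exact_iff_function_exact]
    exact h.exact
  mono_f := (ModuleCat.mono_iff_injective _).2 h.inj
  epi_g := (ModuleCat.epi_iff_surjective _).2 h.surj

theorem SES.ker (g : Y →ₗ[A] Z) (hg : Function.Surjective g) :
    SES (LinearMap.ker g).subtype g :=
  ⟨Subtype.val_injective, hg, fun y => by simp⟩

theorem SES.mkQ (S : Submodule A Y) : SES S.subtype S.mkQ :=
  ⟨Subtype.val_injective, S.mkQ_surjective, fun y => by simp⟩

theorem EV.of_proj [Module.Projective A X] (i : ℕ) (hi : 1 ≤ i) : EV A X W i := by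
  obtain ⟨j, rfl⟩ : ∃ j, i = j + 1 := ⟨i - 1, by omega⟩
  have : Projective (ModuleCat.of A X) := (IsProjective.iff_projective X).1 inferInstance
  exact Ext.subsingleton_of_projective _ _ _

variable {f : X →ₗ[A] Y} {g : Y →ₗ[A] Z}

theorem EV.contra_mid (h : SES f g) {i : ℕ} (hZ : EV A Z W i) (hX : EV A X W i) :
    EV A Y W i := by
  unfold EV at *
  refine subsingleton_of_forall_eq 0 fun e => ?_
  obtain ⟨e', rfl⟩ := Ext.contravariant_sequence_exact₂ h.shortExact _ e
    (@Subsingleton.elim _ hX _ _)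
  have : e' = 0 := @Subsingleton.elim _ hZ _ _
  rw [this, Ext.comp_zero]

theorem EV.contra_right (h : SES f g) {i : ℕ} (hX : EV A X W i) (hY : EV A Y W (i + 1)) :
    EV A Z W (i + 1) := by
  unfold EV at *
  refine subsingleton_of_forall_eq 0 fun e => ?_
  obtain ⟨e', rfl⟩ := Ext.contravariant_sequence_exact₃ h.shortExact _ e
    (@Subsingleton.elim _ hY _ _) (n₀ := i) (by omega)
  have : e' = 0 := @Subsingleton.elim _ hX _ _
  rw [this, Ext.comp_zero]

theorem EV.contra_left (h : SES f g) {i : ℕ} (hY : EV A Y W i) (hZ : EV A Z W (i + 1)) :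
    EV A X W i := by
  unfold EV at *
  refine subsingleton_of_forall_eq 0 fun e => ?_
  obtain ⟨e', rfl⟩ := Ext.contravariant_sequence_exact₁ h.shortExact _ e (n₁ := i + 1) (by omega)
    (@Subsingleton.elim _ hZ _ _)
  have : e' = 0 := @Subsingleton.elim _ hY _ _
  rw [this, Ext.comp_zero]

theorem EV.cov_mid (h : SES f g) {i : ℕ} (hX : EV A W X i) (hZ : EV A W Z i) :
    EV A W Y i := by
  unfold EV at *
  refine subsingleton_of_forall_eq 0 fun e => ?_
  obtain ⟨e', rfl⟩ := Ext.covariant_sequence_exact₂ _ h.shortExact e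
    (@Subsingleton.elim _ hZ _ _)
  have : e' = 0 := @Subsingleton.elim _ hX _ _
  rw [this, Ext.zero_comp]

theorem EV.cov_left (h : SES f g) {i : ℕ} (hZ : EV A W Z i) (hY : EV A W Y (i + 1)) :
    EV A W X (i + 1) := by
  unfold EV at *
  refine subsingleton_of_forall_eq 0 fun e => ?_
  obtain ⟨e', rfl⟩ := Ext.covariant_sequence_exact₁ _ h.shortExact e
    (@Subsingleton.elim _ hY _ _) (n₀ := i) (by omega)
  have : e' = 0 := @Subsingleton.elim _ hZ _ _
  rw [this, Ext.zero_comp]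

theorem EV.cov_right (h : SES f g) {i : ℕ} (hY : EV A W Y i) (hX : EV A W X (i + 1)) :
    EV A W Z i := by
  unfold EV at *
  refine subsingleton_of_forall_eq 0 fun e => ?_
  obtain ⟨e', rfl⟩ := Ext.covariant_sequence_exact₃ _ h.shortExact e (n₁ := i + 1) (by omega)
    (@Subsingleton.elim _ hX _ _)
  have : e' = 0 := @Subsingleton.elim _ hY _ _
  rw [this, Ext.zero_comp]

theorem EV.extend (h : SES f g) (hZ : EV A Z W 1) (φ : X →ₗ[A] W) :
    ∃ ψ : Y →ₗ[A] W, ψ ∘ₗ f = φ := by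
  unfold EV at *
  obtain ⟨e', he⟩ := Ext.contravariant_sequence_exact₁ h.shortExact _
    (Ext.mk₀ (ModuleCat.ofHom φ)) (n₁ := 1) (by omega) (@Subsingleton.elim _ hZ _ _)
  obtain ⟨ψ, rfl⟩ := (Ext.mk₀_bijective _ _).2 e'
  rw [Ext.mk₀_comp_mk₀, (Ext.mk₀_bijective _ _).1.eq_iff] at he
  refine ⟨ψ.hom, ?_⟩
  have := congrArg ModuleCat.Hom.hom he
  simpa using this

theorem EV.of_extend (h : SES f g) (hY : EV A Y W 1)
    (H : ∀ φ : X →ₗ[A] W, ∃ ψ : Y →ₗ[A] W, ψ ∘ₗ f = φ) : EV A Z W 1 := by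
  unfold EV at *
  refine subsingleton_of_forall_eq 0 fun e => ?_
  obtain ⟨e', rfl⟩ := Ext.contravariant_sequence_exact₃ h.shortExact _ e
    (@Subsingleton.elim _ hY _ _) (n₀ := 0) (by omega)
  obtain ⟨φ, rfl⟩ := (Ext.mk₀_bijective _ _).2 e'
  obtain ⟨ψ, hψ⟩ := H φ.hom
  have : φ = ModuleCat.ofHom f ≫ ModuleCat.ofHom ψ := by
    ext x; exact (LinearMap.congr_fun hψ x).symm
  rw [this, ← Ext.mk₀_comp_mk₀]
  exact ShortComplex.ShortExact.extClass_comp_assoc h.shortExact _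

theorem EV.lift (h : SES f g) (hX : EV A W X 1) (φ : W →ₗ[A] Z) :
    ∃ ψ : W →ₗ[A] Y, g ∘ₗ ψ = φ := by
  unfold EV at *
  obtain ⟨e', he⟩ := Ext.covariant_sequence_exact₃ _ h.shortExact
    (Ext.mk₀ (ModuleCat.ofHom φ)) (n₁ := 1) (by omega) (@Subsingleton.elim _ hX _ _)
  obtain ⟨ψ, rfl⟩ := (Ext.mk₀_bijective _ _).2 e'
  rw [Ext.mk₀_comp_mk₀, (Ext.mk₀_bijective _ _).1.eq_iff] at he
  refine ⟨ψ.hom, ?_⟩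
  have := congrArg ModuleCat.Hom.hom he
  simpa using this

theorem EV.of_lift (h : SES f g) (hY : EV A W Y 1)
    (H : ∀ φ : W →ₗ[A] Z, ∃ ψ : W →ₗ[A] Y, g ∘ₗ ψ = φ) : EV A W X 1 := by
  unfold EV at *
  refine subsingleton_of_forall_eq 0 fun e => ?_
  obtain ⟨e', rfl⟩ := Ext.covariant_sequence_exact₁ _ h.shortExact e
    (@Subsingleton.elim _ hY _ _) (n₀ := 0) (by omega)
  obtain ⟨φ, rfl⟩ := (Ext.mk₀_bijective _ _).2 e'
  obtain ⟨ψ, hψ⟩ := H φ.hom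
  have : φ = ModuleCat.ofHom ψ ≫ ModuleCat.ofHom g := by
    ext x; exact (LinearMap.congr_fun hψ x).symm
  rw [this, ← Ext.mk₀_comp_mk₀, Ext.comp_assoc_of_second_deg_zero]
  simp [ShortComplex.ShortExact.comp_extClass h.shortExact]

theorem EV.zero_left [Subsingleton X] (i : ℕ) : EV A X W i := by
  refine subsingleton_of_forall_eq 0 fun e => ?_
  rw [← Ext.mk₀_id_comp e]
  have : 𝟙 (ModuleCat.of A X) = 0 := by ext x; exact Subsingleton.elim (α := X) _ _
  rw [this, Ext.mk₀_zero, Ext.zero_comp]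

theorem EV.zero_right [Subsingleton X] (i : ℕ) : EV A W X i := by
  refine subsingleton_of_forall_eq 0 fun e => ?_
  rw [← Ext.comp_mk₀_id e]
  have : 𝟙 (ModuleCat.of A X) = 0 := by ext x; exact Subsingleton.elim (α := X) _ _
  rw [this, Ext.mk₀_zero, Ext.comp_zero]

theorem EV.congr_left (e : X ≃ₗ[A] Y) {i : ℕ} (h : EV A X W i) : EV A Y W i := by
  refine EV.contra_mid (X := X) (Z := PUnit) (f := e.toLinearMap) (g := 0) ⟨e.injective, ?_, ?_⟩
    (EV.zero_left i) h
  · exact fun _ => ⟨0, Subsingleton.elim _ _⟩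
  · intro y; simp

theorem EV.congr_right (e : X ≃ₗ[A] Y) {i : ℕ} (h : EV A W X i) : EV A W Y i := by
  refine EV.cov_mid (X := X) (Z := PUnit) (f := e.toLinearMap) (g := 0) ⟨e.injective, ?_, ?_⟩
    h (EV.zero_right i)
  · exact fun _ => ⟨0, Subsingleton.elim _ _⟩
  · intro y; simp

theorem SES.prod : SES (LinearMap.inl A X Y) (LinearMap.snd A X Y) :=
  ⟨LinearMap.inl_injective, LinearMap.snd_surjective, Function.Exact.inl_snd⟩ 

theorem EV.pi_left {i : ℕ} (h : EV A X W i) (n : ℕ) : EV A (Fin n → X) W i := by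
  induction n with
  | zero => exact EV.zero_left i
  | succ n ih =>
    refine EV.congr_left (Fin.consLinearEquiv A (fun _ : Fin (n+1) => X)) ?_
    exact EV.contra_mid SES.prod ih h

theorem EV.pi_right {i : ℕ} (h : EV A W X i) (n : ℕ) : EV A W (Fin n → X) i := by
  induction n with
  | zero => exact EV.zero_right i
  | succ n ih =>
    refine EV.congr_right (Fin.consLinearEquiv A (fun _ : Fin (n+1) => X)) ?_
    exact EV.cov_mid SES.prod h ih

end EVBasics

section Bridge

open CategoryTheory.Abelian

theorem extMod_iff (A : Type) [CommRing A] (M N : Type) [AddCommGroup M] [AddCommGroup N]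
    [mM : Module A M] [mN : Module A N] (i : ℕ) (hi : 1 ≤ i) :
    Subsingleton (extMod A M N mM mN i) ↔ EV A M N i := by
  obtain ⟨p, rfl⟩ : ∃ j, i = j + 1 := ⟨i - 1, by omega⟩
  let P := ProjectiveResolution.of (ModuleCat.of A M)
  have h1 : Subsingleton (extMod A M N mM mN (p+1)) ↔
      ((P.complex.linearYonedaObj A (ModuleCat.of A N)).ExactAt (p+1)) := by
    rw [HomologicalComplex.exactAt_iff_isZero_homology, ← ModuleCat.isZero_iff_subsingleton]
    exact (P.isoExt (R := A) (p+1) (ModuleCat.of A N)).isZero_iff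
  rw [h1, HomologicalComplex.exactAt_iff' _ p (p+1) (p+2) (by simp) (by simp),
    ShortComplex.moduleCat_exact_iff]
  have h2 : (∀ f : P.complex.X (p+1) ⟶ ModuleCat.of A N, P.complex.d (p+2) (p+1) ≫ f = 0 →
      ∃ g : P.complex.X p ⟶ ModuleCat.of A N, P.complex.d (p+1) p ≫ g = f) ↔ EV A M N (p+1) := by
    constructor
    · intro H
      refine subsingleton_of_forall_eq 0 fun e => ?_
      obtain ⟨f, hf, rfl⟩ := P.extMk_surjective e (p+2) rfl
      exact (P.extMk_eq_zero_iff f _ rfl hf p rfl).2 (H f hf)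
    · intro H f hf
      exact (P.extMk_eq_zero_iff f _ rfl hf p rfl).1 (@Subsingleton.elim _ H _ _)
  rw [← h2]
  exact Iff.rfl

end Bridge

section ChangeRing

open CategoryTheory.Abelian TensorProduct

theorem EV.shift {A : Type} [CommRing A]
    {X Y Z W : Type} [AddCommGroup X] [Module A X] [AddCommGroup Y] [Module A Y]
    [AddCommGroup Z] [Module A Z] [AddCommGroup W] [Module A W]
    {f : X →ₗ[A] Y} {g : Y →ₗ[A] Z} (h : SES f g) [Module.Projective A Y] (i : ℕ) (hi : 1 ≤ i) :
    EV A Z W (i + 1) ↔ EV A X W i :=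
  ⟨fun H => EV.contra_left h (EV.of_proj i hi) H,
    fun H => EV.contra_right h H (EV.of_proj (i+1) (by omega))⟩

theorem LinearMap.exists_factor' {A : Type} [CommRing A]
    {X Y Z : Type} [AddCommGroup X] [Module A X] [AddCommGroup Y] [Module A Y]
    [AddCommGroup Z] [Module A Z] (p : X →ₗ[A] Y) (hp : Function.Surjective p)
    (φ : X →ₗ[A] Z) (h : ∀ x, p x = 0 → φ x = 0) : ∃ ψ : Y →ₗ[A] Z, ψ ∘ₗ p = φ := by
  refine ⟨(LinearMap.ker p).liftQ φ (fun x hx => h x hx) ∘ₗ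
    (p.quotKerEquivOfSurjective hp).symm.toLinearMap, ?_⟩
  ext x
  have : (p.quotKerEquivOfSurjective hp).symm (p x) = (LinearMap.ker p).mkQ x := by
    rw [LinearEquiv.symm_apply_eq]; rfl
  simp only [LinearMap.comp_apply, LinearEquiv.coe_coe, this]
  exact Submodule.liftQ_apply _ _ _

theorem finsupp_reg {B : Type} [CommRing B] (x : B) (hx : IsSMulRegular B x) (L : Type) :
    IsSMulRegular (L →₀ B) x := by
  intro a b hab
  ext i
  exact hx (by simpa using DFunLike.congr_fun hab i)

variable {B A : Type} [CommRing B] [CommRing A] [Algebra B A]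

theorem tens_surj (hs : Function.Surjective (algebraMap B A))
    (L : Type) [AddCommGroup L] [Module B L] (t : A ⊗[B] L) : ∃ l : L, t = 1 ⊗ₜ[B] l := by
  induction t with
  | zero => exact ⟨0, by simp⟩
  | tmul a l =>
    obtain ⟨b, rfl⟩ := hs a
    exact ⟨b • l, by rw [tmul_smul, smul_tmul', Algebra.smul_def, mul_one]⟩
  | add s t hs ht =>
    obtain ⟨l, rfl⟩ := hs
    obtain ⟨m, rfl⟩ := ht
    exact ⟨l + m, by rw [tmul_add]⟩

theorem tens_ker (hs : Function.Surjective (algebraMap B A)) (x : B)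
    (hk : ∀ b : B, algebraMap B A b = 0 ↔ ∃ c, b = x * c)
    (L : Type) [AddCommGroup L] [Module B L] (l : L) :
    (1 : A) ⊗ₜ[B] l = 0 ↔ ∃ l', l = x • l' := by
  constructor
  · intro h
    have he : Function.Exact (LinearMap.lsmul B B x) (Algebra.linearMap B A) := by
      intro b
      rw [Algebra.linearMap_apply, hk]
      simp [eq_comm]
    have := rTensor_exact L he hs ((1 : B) ⊗ₜ[B] l)
    obtain ⟨t, ht⟩ := this.1 (by simpa using h)
    refine ⟨TensorProduct.lid B L t, ?_⟩
    have h2 : TensorProduct.lid B L ((LinearMap.rTensor L (LinearMap.lsmul B B x)) t) =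
        x • TensorProduct.lid B L t := by
      clear ht this h
      induction t with
      | zero => simp
      | tmul a l => simp [mul_smul]
      | add s t hs ht => rw [map_add, map_add, hs, ht, map_add, smul_add]
    rw [← h2, ht]; simp
  · rintro ⟨l', rfl⟩
    rw [tmul_smul, smul_tmul', Algebra.smul_def, mul_one, (hk x).2 ⟨1, by simp⟩, zero_tmul]

theorem smul_tower_zero (x : B)
    (hk : ∀ b : B, algebraMap B A b = 0 ↔ ∃ c, b = x * c)
    (N : Type) [AddCommGroup N] [Module A N] [Module B N]
    [IsScalarTower B A N] (n : N) : x • n = 0 := by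
  rw [← one_smul A n, ← smul_assoc, Algebra.smul_def, mul_one, (hk x).2 ⟨1, by simp⟩, zero_smul]

theorem KLses (hs : Function.Surjective (algebraMap B A)) (x : B)
    (hk : ∀ b : B, algebraMap B A b = 0 ↔ ∃ c, b = x * c)
    (P L Lb : Type) [AddCommGroup P] [Module B P] [AddCommGroup L] [Module B L]
    [AddCommGroup Lb] [Module B Lb] [Module A Lb] [IsScalarTower B A Lb] (π : L →ₗ[B] Lb)
    (hπ : Function.Surjective π) (hπk : ∀ l, π l = 0 ↔ ∃ l', l = x • l')
    (hL : IsSMulRegular L x) (p : P →ₗ[B] L) (hp : Function.Surjective p) :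
    SES ((LinearMap.ker p).subtype.baseChange A) (LinearMap.liftBaseChange A (π ∘ₗ p)) := by
  refine ⟨?_, ?_, ?_⟩
  · rw [injective_iff_map_eq_zero]
    intro t ht
    obtain ⟨l, rfl⟩ := tens_surj hs _ t
    rw [LinearMap.baseChange_tmul, tens_ker hs x hk] at ht
    obtain ⟨q, hq⟩ := ht
    rw [tens_ker hs x hk]
    have h1 : x • p q = 0 := by
      rw [← map_smul, ← hq]; exact l.2
    refine ⟨⟨q, hL.right_eq_zero_of_smul h1⟩, Subtype.ext hq⟩
  · intro y
    obtain ⟨l, rfl⟩ := hπ y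
    obtain ⟨q, rfl⟩ := hp l
    exact ⟨1 ⊗ₜ q, by simp⟩
  · intro t
    obtain ⟨q, rfl⟩ := tens_surj hs _ t
    constructor
    · intro h
      have h : π (p q) = 0 := by simpa using h
      obtain ⟨l, hl⟩ := (hπk _).1 h
      obtain ⟨q', rfl⟩ := hp l
      refine ⟨1 ⊗ₜ ⟨q - x • q', by simp [hl]⟩, ?_⟩
      rw [LinearMap.baseChange_tmul]
      have : (1 : A) ⊗ₜ[B] (x • q') = 0 := (tens_ker hs x hk _ _).2 ⟨q', rfl⟩
      simp [tmul_sub, this]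
    · rintro ⟨s, hs'⟩
      obtain ⟨l, rfl⟩ := tens_surj hs _ s
      rw [← hs']
      simp

theorem KL (hs : Function.Surjective (algebraMap B A)) (x : B)
    (hk : ∀ b : B, algebraMap B A b = 0 ↔ ∃ c, b = x * c)
    (hx : IsSMulRegular B x) (i : ℕ) : ∀ (L Lb : Type) [AddCommGroup L] [Module B L] [AddCommGroup Lb]
    [Module B Lb] [Module A Lb] [IsScalarTower B A Lb] (π : L →ₗ[B] Lb)
    (_ : Function.Surjective π) (_ : ∀ l, π l = 0 ↔ ∃ l', l = x • l')
    (_ : IsSMulRegular L x) (N : Type) [AddCommGroup N] [Module A N] [Module B N]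
    [IsScalarTower B A N], EV B L N (i+1) ↔ EV A Lb N (i+1) := by
  induction i with
  | zero =>
    intro L Lb _ _ _ _ _ _ π hπ hπk hL N _ _ _ _
    let p : (L →₀ B) →ₗ[B] L := Finsupp.linearCombination B id
    have hp : Function.Surjective p := Finsupp.linearCombination_id_surjective B L
    have S1 := SES.ker p hp
    have S2 := KLses hs x hk _ L Lb π hπ hπk hL p hp
    constructor
    · intro h
      refine EV.of_extend S2 (EV.of_proj _ le_rfl) fun φ => ?_
      obtain ⟨ψ, hψ⟩ := EV.extend S1 h
        ((φ.restrictScalars B) ∘ₗ (TensorProduct.mk B A (LinearMap.ker p) 1))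
      refine ⟨LinearMap.liftBaseChange A ψ, ?_⟩
      apply LinearMap.ext
      intro t
      obtain ⟨l, rfl⟩ := tens_surj hs (LinearMap.ker p) t
      have := LinearMap.congr_fun hψ l
      simpa using this
    · intro h
      refine EV.of_extend S1 (EV.of_proj _ le_rfl) fun φ => ?_
      obtain ⟨ψ, hψ⟩ := EV.extend S2 h (LinearMap.liftBaseChange A φ)
      refine ⟨(ψ.restrictScalars B) ∘ₗ (TensorProduct.mk B A (L →₀ B) 1), ?_⟩
      apply LinearMap.ext
      intro l
      have := LinearMap.congr_fun hψ (1 ⊗ₜ l)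
      simpa using this
  | succ i ih =>
    intro L Lb _ _ _ _ _ _ π hπ hπk hL N _ _ _ _
    let p : (L →₀ B) →ₗ[B] L := Finsupp.linearCombination B id
    have hp : Function.Surjective p := Finsupp.linearCombination_id_surjective B L
    have S1 := SES.ker p hp
    have S2 := KLses hs x hk _ L Lb π hπ hπk hL p hp
    rw [EV.shift S1 _ (by omega), EV.shift S2 _ (by omega)]
    refine ih (LinearMap.ker p) (A ⊗[B] LinearMap.ker p) (TensorProduct.mk B A _ 1) ?_ ?_ ?_ N
    · intro t
      obtain ⟨l, rfl⟩ := tens_surj hs (LinearMap.ker p) t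
      exact ⟨l, rfl⟩
    · intro l
      exact tens_ker hs x hk (LinearMap.ker p) l
    · intro a b hab
      exact Subtype.ext (finsupp_reg x hx L (congrArg Subtype.val hab))

end ChangeRing

section ChangeRing2

open CategoryTheory.Abelian TensorProduct

theorem fourTerm {B A : Type} [CommRing B] [CommRing A] [Algebra B A]
    (hs : Function.Surjective (algebraMap B A)) (x : B)
    (hk : ∀ b : B, algebraMap B A b = 0 ↔ ∃ c, b = x * c) (hx : IsSMulRegular B x)
    (M : Type) [AddCommGroup M] [Module A M] [Module B M] [IsScalarTower B A M]
    (p : (M →₀ B) →ₗ[B] M) (hp : Function.Surjective p) :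
    ∃ (j : M →ₗ[A] A ⊗[B] LinearMap.ker p)
      (r : A ⊗[B] LinearMap.ker p →ₗ[A] LinearMap.ker (LinearMap.liftBaseChange A p)),
      SES (Z := LinearMap.ker (LinearMap.liftBaseChange A p)) j r := by
  have hxM := smul_tower_zero x hk M
  let s : (M →₀ B) →ₗ[B] LinearMap.ker p :=
    LinearMap.codRestrict (LinearMap.ker p) (x • LinearMap.id) (fun q => by
      simp only [LinearMap.mem_ker, LinearMap.smul_apply, LinearMap.id_apply, map_smul, hxM])
  have hsv : ∀ q, (s q : M →₀ B) = x • q := fun q => rfl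
  obtain ⟨j0, hj0⟩ := LinearMap.exists_factor' p hp
    ((TensorProduct.mk B A (LinearMap.ker p) 1) ∘ₗ s) (fun q hq => by
      show (1 : A) ⊗ₜ[B] s q = 0
      refine (tens_ker hs x hk (LinearMap.ker p) (s q)).2 ?_
      exact ⟨⟨q, hq⟩, Subtype.ext rfl⟩)
  have hj0' : ∀ q, j0 (p q) = (1 : A) ⊗ₜ[B] s q := fun q => LinearMap.congr_fun hj0 q
  let j : M →ₗ[A] A ⊗[B] LinearMap.ker p := LinearMap.extendScalarsOfSurjective hs j0
  have hj : ∀ q, j (p q) = (1 : A) ⊗ₜ[B] s q := hj0'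
  let r : A ⊗[B] LinearMap.ker p →ₗ[A] LinearMap.ker (LinearMap.liftBaseChange A p) :=
    LinearMap.codRestrict _ ((LinearMap.ker p).subtype.baseChange A) (fun t => by
      obtain ⟨l, rfl⟩ := tens_surj hs (LinearMap.ker p) t
      simp)
  have hr : ∀ l, (r ((1 : A) ⊗ₜ[B] l) : A ⊗[B] (M →₀ B)) = (1 : A) ⊗ₜ[B] (l : M →₀ B) :=
    fun l => rfl
  refine ⟨j, r, ?_, ?_, ?_⟩
  · rw [injective_iff_map_eq_zero]
    intro m hm
    obtain ⟨q, rfl⟩ := hp m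
    rw [hj] at hm
    obtain ⟨l, hl⟩ := (tens_ker hs x hk (LinearMap.ker p) (s q)).1 hm
    have : q = l := finsupp_reg x hx M (congrArg Subtype.val hl)
    rw [this]; exact l.2
  · rintro ⟨t, ht⟩
    obtain ⟨q, rfl⟩ := tens_surj hs _ t
    have hq : p q = 0 := by simpa using ht
    exact ⟨1 ⊗ₜ ⟨q, hq⟩, Subtype.ext rfl⟩
  · intro t
    obtain ⟨l, rfl⟩ := tens_surj hs (LinearMap.ker p) t
    constructor
    · intro h
      have h := congrArg Subtype.val h
      rw [hr] at h
      obtain ⟨q, hq⟩ := (tens_ker hs x hk _ _).1 h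
      exact ⟨p q, by rw [hj]; congr 1; exact Subtype.ext hq.symm⟩
    · rintro ⟨m, hm⟩
      obtain ⟨q, rfl⟩ := hp m
      rw [← hm, hj]
      apply Subtype.ext
      rw [hr]
      exact (tens_ker hs x hk _ _).2 ⟨q, rfl⟩

theorem changeA {B A : Type} [CommRing B] [CommRing A] [Algebra B A]
    (hs : Function.Surjective (algebraMap B A)) (x : B)
    (hk : ∀ b : B, algebraMap B A b = 0 ↔ ∃ c, b = x * c) (hx : IsSMulRegular B x)
    (M : Type) [AddCommGroup M] [Module A M] [Module B M] [IsScalarTower B A M]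
    (N : Type) [AddCommGroup N] [Module A N] [Module B N] [IsScalarTower B A N]
    (i : ℕ) (hi : 1 ≤ i) :
    (EV B M N (i+1) → EV A M N (i+2) → EV A M N i) ∧
    (EV A M N (i+1) → EV A M N i → EV B M N (i+1)) := by
  let p : (M →₀ B) →ₗ[B] M := Finsupp.linearCombination B id
  have hp : Function.Surjective p := Finsupp.linearCombination_id_surjective B M
  obtain ⟨j, r, S⟩ := fourTerm hs x hk hx M p hp
  have S1 := SES.ker p hp
  have hq : Function.Surjective (LinearMap.liftBaseChange A p) := by
    intro m
    obtain ⟨q, rfl⟩ := hp m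
    exact ⟨1 ⊗ₜ q, by simp⟩
  have S2 := SES.ker _ hq
  have hKL : EV B (LinearMap.ker p) N i ↔ EV A (A ⊗[B] LinearMap.ker p) N i := by
    obtain ⟨i, rfl⟩ := Nat.exists_eq_add_of_le' hi
    refine KL hs x hk hx i (LinearMap.ker p) _ (TensorProduct.mk B A _ 1) ?_ ?_ ?_ N
    · intro t
      obtain ⟨l, rfl⟩ := tens_surj hs (LinearMap.ker p) t
      exact ⟨l, rfl⟩
    · intro l
      exact tens_ker hs x hk (LinearMap.ker p) l
    · intro a b hab
      exact Subtype.ext (finsupp_reg x hx M (congrArg Subtype.val hab))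
  constructor
  · intro h1 h2
    rw [EV.shift S1 i hi, hKL] at h1
    rw [EV.shift S2 (i+1) (by omega)] at h2
    exact EV.contra_left S h1 h2
  · intro h1 h2
    rw [EV.shift S2 i hi] at h1
    rw [EV.shift S1 i hi, hKL]
    exact EV.contra_mid S h1 h2

theorem SES.mulx {B A : Type} [CommRing B] [CommRing A] [Algebra B A]
    (hs : Function.Surjective (algebraMap B A)) (x : B)
    (hk : ∀ b : B, algebraMap B A b = 0 ↔ ∃ c, b = x * c)
    (P : Type) [AddCommGroup P] [Module B P] (hP : IsSMulRegular P x) :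
    SES (x • LinearMap.id : P →ₗ[B] P) (TensorProduct.mk B A P 1) := by
  refine ⟨hP, ?_, ?_⟩
  · intro t
    obtain ⟨l, rfl⟩ := tens_surj hs P t
    exact ⟨l, rfl⟩
  · intro l
    refine (tens_ker hs x hk P l).trans ?_
    simp [eq_comm]

theorem rees1 {B A : Type} [CommRing B] [CommRing A] [Algebra B A]
    (hs : Function.Surjective (algebraMap B A)) (x : B)
    (hk : ∀ b : B, algebraMap B A b = 0 ↔ ∃ c, b = x * c) (hx : IsSMulRegular B x)
    (M : Type) [AddCommGroup M] [Module A M] [Module B M] [IsScalarTower B A M]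
    (h : EV B M B 2) : EV A M A 1 := by
  let p : (M →₀ B) →ₗ[B] M := Finsupp.linearCombination B id
  have hp : Function.Surjective p := Finsupp.linearCombination_id_surjective B M
  have hxM := smul_tower_zero x hk M
  have S1 := SES.ker p hp
  have hq : Function.Surjective (LinearMap.liftBaseChange A p) := by
    intro m
    obtain ⟨q, rfl⟩ := hp m
    exact ⟨1 ⊗ₜ q, by simp⟩
  have S2 := SES.ker _ hq
  rw [EV.shift S1 1 le_rfl] at h
  have S3 : SES (x • LinearMap.id : B →ₗ[B] B) (Algebra.linearMap B A) := by
    refine ⟨hx, hs, ?_⟩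
    intro b
    rw [Algebra.linearMap_apply, hk]
    simp [eq_comm]
  refine EV.of_extend S2 (EV.of_proj _ le_rfl) fun φ => ?_
  have hmem : ∀ l : LinearMap.ker p, (1 : A) ⊗ₜ[B] (l : M →₀ B) ∈
      LinearMap.ker (LinearMap.liftBaseChange A p) := by
    intro l; simp
  let ρ : LinearMap.ker p →ₗ[B] LinearMap.ker (LinearMap.liftBaseChange A p) :=
    { toFun := fun l => ⟨(1 : A) ⊗ₜ[B] (l : M →₀ B), hmem l⟩
      map_add' := fun a b => Subtype.ext (by simp [tmul_add])
      map_smul' := fun a b => Subtype.ext (by simp) }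
  obtain ⟨φ2, hφ2⟩ := EV.lift S3 h ((φ.restrictScalars B) ∘ₗ ρ)
  have hφ3 : ∀ l, algebraMap B A (φ2 l) = φ (ρ l) := fun l => LinearMap.congr_fun hφ2 l
  have hxq : ∀ q : M →₀ B, x • q ∈ LinearMap.ker p := fun q => by
    simp [LinearMap.mem_ker, hxM]
  have hdiv : ∀ q : M →₀ B, ∃ c, φ2 ⟨x • q, hxq q⟩ = x * c := by
    intro q
    rw [← hk, hφ3]
    have : ρ ⟨x • q, hxq q⟩ = 0 := Subtype.ext ((tens_ker hs x hk _ _).2 ⟨q, rfl⟩)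
    rw [this, map_zero]
  choose ψ0 hψ0 using hdiv
  let ψ : (M →₀ B) →ₗ[B] B :=
    { toFun := ψ0
      map_add' := fun a b => hx (by
        simp only [smul_eq_mul, mul_add, ← hψ0, ← map_add]
        congr 1
        exact Subtype.ext (smul_add _ _ _))
      map_smul' := fun b a => hx (by
        simp only [smul_eq_mul, RingHom.id_apply]
        rw [mul_left_comm, ← hψ0, ← hψ0, ← smul_eq_mul, ← map_smul]
        congr 1
        exact Subtype.ext (smul_comm _ _ _)) }
  have hψ : ∀ l : LinearMap.ker p, ψ l = φ2 l := fun l => hx (by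
    show x * ψ0 l = x * φ2 l
    rw [← hψ0, ← smul_eq_mul, ← map_smul]
    rfl)
  refine ⟨LinearMap.liftBaseChange A ((Algebra.linearMap B A) ∘ₗ ψ), ?_⟩
  apply LinearMap.ext
  rintro ⟨t, ht⟩
  obtain ⟨q, rfl⟩ := tens_surj hs _ t
  have hq : p q = 0 := by simpa using ht
  have h1 := hψ ⟨q, hq⟩
  have h2 := hφ3 ⟨q, hq⟩
  rw [← h1] at h2
  have h3 : φ ⟨1 ⊗ₜ[B] q, ht⟩ = φ (ρ ⟨q, hq⟩) := rfl
  rw [h3]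
  simpa using h2

theorem rees {B A : Type} [CommRing B] [CommRing A] [Algebra B A]
    (hs : Function.Surjective (algebraMap B A)) (x : B)
    (hk : ∀ b : B, algebraMap B A b = 0 ↔ ∃ c, b = x * c) (hx : IsSMulRegular B x) (i : ℕ) :
    ∀ (M : Type) [AddCommGroup M] [Module A M] [Module B M] [IsScalarTower B A M]
    (_ : EV B M B (i+2)), EV A M A (i+1) := by
  induction i with
  | zero => intro M _ _ _ _ h; exact rees1 hs x hk hx M h
  | succ i ih =>
    intro M _ _ _ _ h
    let p : (M →₀ B) →ₗ[B] M := Finsupp.linearCombination B id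
    have hp : Function.Surjective p := Finsupp.linearCombination_id_surjective B M
    have hq : Function.Surjective (LinearMap.liftBaseChange A p) := by
      intro m
      obtain ⟨q, rfl⟩ := hp m
      exact ⟨1 ⊗ₜ q, by simp⟩
    have S2 := SES.ker _ hq
    rw [EV.shift S2 _ (by omega)]
    apply ih
    let ι : LinearMap.ker (LinearMap.liftBaseChange A p) →ₗ[B] A ⊗[B] (M →₀ B) :=
      LinearMap.restrictScalars B (LinearMap.ker (LinearMap.liftBaseChange A p)).subtype
    let π : A ⊗[B] (M →₀ B) →ₗ[B] M :=
      LinearMap.restrictScalars B (LinearMap.liftBaseChange A p)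
    have S3 : SES (X := LinearMap.ker (LinearMap.liftBaseChange A p)) ι π := ⟨S2.inj, S2.surj, fun t => S2.exact t⟩
    have hF : EV B (A ⊗[B] (M →₀ B)) B (i+1+1) :=
      EV.contra_right (SES.mulx hs x hk (M →₀ B) (finsupp_reg x hx M))
        (EV.of_proj _ (by omega)) (EV.of_proj _ (by omega))
    exact EV.contra_left S3 hF h

/-- `Ext` bounds over a ring. -/
structure PB (A : Type) [CommRing A] (b : ℕ) : Prop where
  ab : ∀ (M N : Type) [AddCommGroup M] [Module A M] [AddCommGroup N] [Module A N]
    [Module.Finite A M] [Module.Finite A N], (∃ n₀, ∀ i, n₀ ≤ i → EV A M N i) → ∀ i, b < i → EV A M N i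
  gor : ∀ (M : Type) [AddCommGroup M] [Module A M] [Module.Finite A M],
    ∀ i, b < i → EV A M A i

theorem PB.descend {B A : Type} [CommRing B] [CommRing A] [Algebra B A]
    (hs : Function.Surjective (algebraMap B A)) (x : B)
    (hk : ∀ b : B, algebraMap B A b = 0 ↔ ∃ c, b = x * c) (hx : IsSMulRegular B x)
    (b : ℕ) (h : PB B b) : PB A b := by
  have : Module.Finite B A := Module.Finite.of_surjective (Algebra.linearMap B A) hs
  refine ⟨?_, ?_⟩
  · intro M N _ _ _ _ _ _ ⟨n₀, hn⟩ i hi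
    let : Module B M := Module.compHom M (algebraMap B A)
    let : Module B N := Module.compHom N (algebraMap B A)
    have : IsScalarTower B A M := ⟨fun a b c => by
      rw [Algebra.smul_def, mul_smul]; rfl⟩
    have : IsScalarTower B A N := ⟨fun a b c => by
      rw [Algebra.smul_def, mul_smul]; rfl⟩
    have : Module.Finite B M := Module.Finite.trans A M
    have : Module.Finite B N := Module.Finite.trans A N
    have hB : ∀ i, b < i → EV B M N i := by
      apply h.ab M N
      refine ⟨n₀ + 2, fun i hi => ?_⟩
      obtain ⟨i, rfl⟩ : ∃ k, i = k + 1 := ⟨i - 1, by omega⟩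
      exact (changeA hs x hk hx M N i (by omega)).2 (hn _ (by omega)) (hn _ (by omega))
    have key : ∀ k i, b < i → n₀ ≤ i + k → EV A M N i := by
      intro k
      induction k using Nat.strong_induction_on with
      | _ k ih =>
        intro i hi hk'
        rcases Nat.eq_zero_or_pos k with rfl | hk0
        · exact hn i hk'
        · exact (changeA hs x hk hx M N i (by omega)).1 (hB _ (by omega))
            (ih (k - 1) (by omega) (i+2) (by omega) (by omega))
    exact key n₀ i hi (by omega)
  · intro M _ _ _ i hi
    let : Module B M := Module.compHom M (algebraMap B A)
    have : IsScalarTower B A M := ⟨fun a b c => by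
      rw [Algebra.smul_def, mul_smul]; rfl⟩
    have : Module.Finite B M := Module.Finite.trans A M
    obtain ⟨i, rfl⟩ : ∃ k, i = k + 1 := ⟨i - 1, by omega⟩
    exact rees hs x hk hx i M (h.gor M _ (by omega))

end ChangeRing2

section BaseRing

open CategoryTheory.Abelian TensorProduct

theorem EV.nakayama {A : Type} [CommRing A] [IsNoetherianRing A] [IsLocalRing A]
    {L N Nb : Type} [AddCommGroup L] [Module A L] [AddCommGroup N] [Module A N]
    [AddCommGroup Nb] [Module A Nb] [Module.Finite A L] [Module.Finite A N]
    (x : A) (hx : x ∈ maximalIdeal A) {g : N →ₗ[A] Nb}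
    (S : SES (x • LinearMap.id : N →ₗ[A] N) g) (i : ℕ) (h : EV A L Nb i) : EV A L N i := by
  have fin : Module.Finite A (Ext (ModuleCat.of A L) (ModuleCat.of A N) i) := inferInstance
  have gen : ∀ e : Ext (ModuleCat.of A L) (ModuleCat.of A N) i,
      e.comp (Ext.mk₀ (ModuleCat.ofHom (x • LinearMap.id : N →ₗ[A] N))) (add_zero i) = x • e := by
    intro e
    have : ModuleCat.ofHom (x • LinearMap.id : N →ₗ[A] N) = x • 𝟙 (ModuleCat.of A N) := rfl
    rw [this]
    simp [Ext.mk₀_smul]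
  have key : ∀ e : Ext (ModuleCat.of A L) (ModuleCat.of A N) i, ∃ e', e = x • e' := by
    intro e
    obtain ⟨e', he'⟩ := Ext.covariant_sequence_exact₂ (ModuleCat.of A L) S.shortExact e
      (h.elim _ _)
    exact ⟨e', he'.symm.trans (gen e')⟩
  have hle : (⊤ : Submodule A (Ext (ModuleCat.of A L) (ModuleCat.of A N) i)) ≤
      maximalIdeal A • ⊤ := by
    intro e _
    obtain ⟨e', rfl⟩ := key e
    exact Submodule.smul_mem_smul hx trivial
  have := Submodule.eq_bot_of_le_smul_of_le_jacobson_bot (maximalIdeal A) ⊤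
    fin.fg_top hle (IsLocalRing.maximalIdeal_le_jacobson _)
  have h2 : Subsingleton (Submodule A (Ext (ModuleCat.of A L) (ModuleCat.of A N) i)) :=
    subsingleton_of_bot_eq_top this.symm
  exact (Submodule.subsingleton_iff A).1 h2

theorem fin_reg {B : Type} [CommRing B] (x : B) (hx : IsSMulRegular B x) (n : ℕ) :
    IsSMulRegular (Fin n → B) x := by
  intro a b hab
  ext i
  exact hx (congrFun hab i)

theorem exists_syz (A : Type) [CommRing A] [IsNoetherianRing A] (X : Type) [AddCommGroup X]
    [Module A X] [Module.Finite A X] : ∃ (r : ℕ) (g : (Fin r → A) →ₗ[A] X),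
      Function.Surjective g := Module.Finite.exists_fin' A X

theorem quot_mk_ker {B : Type} [CommRing B] (x : B) (b : B) :
    algebraMap B (B ⧸ Ideal.span {x}) b = 0 ↔ ∃ c, b = x * c := by
  rw [Ideal.Quotient.algebraMap_eq, Ideal.Quotient.eq_zero_iff_mem, Ideal.mem_span_singleton]
  rfl

theorem weak_cons {B : Type} [CommRing B] (x : B) (rs : List B)
    (h : RingTheory.Sequence.IsWeaklyRegular B (x :: rs)) :
    IsSMulRegular B x ∧ RingTheory.Sequence.IsWeaklyRegular (B ⧸ Ideal.span {x})
      (rs.map (algebraMap B (B ⧸ Ideal.span {x}))) := by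
  rw [RingTheory.Sequence.isWeaklyRegular_cons_iff] at h
  refine ⟨h.1, ?_⟩
  rw [RingTheory.Sequence.isWeaklyRegular_map_algebraMap_iff]
  have e : QuotSMulTop x B ≃ₗ[B] B ⧸ Ideal.span {x} := Submodule.quotEquivOfEq _ _ (by
    rw [← Submodule.ideal_span_singleton_smul, smul_eq_mul, Ideal.mul_top])
  exact (e.isWeaklyRegular_congr rs).1 h.2

theorem base_bound (n : ℕ) : ∀ (Q : Type) [CommRing Q] [IsLocalRing Q] [IsNoetherianRing Q]
    (rs : List Q), rs.length = n → RingTheory.Sequence.IsWeaklyRegular Q rs →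
    Ideal.ofList rs = maximalIdeal Q →
    ∀ (M N : Type) [AddCommGroup M] [Module Q M] [AddCommGroup N] [Module Q N]
    [Module.Finite Q M] [Module.Finite Q N] (i : ℕ), n < i → EV Q M N i := by
  induction n with
  | zero =>
    intro Q _ _ _ rs hrs _ hm M N _ _ _ _ _ _ i hi
    rw [List.length_eq_zero_iff] at hrs
    subst hrs
    rw [Ideal.ofList_nil] at hm
    have hf : IsField Q := IsLocalRing.isField_iff_maximalIdeal_eq.2 hm.symm
    let _ := hf.toField
    have : Module.Free Q M := inferInstance
    exact EV.of_proj i hi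
  | succ n ih =>
    intro Q _ _ _ rs hrs hw hm M N _ _ _ _ _ _ i hi
    obtain ⟨x, rs, rfl⟩ := List.exists_cons_of_length_eq_add_one hrs
    obtain ⟨hx, hw'⟩ := weak_cons x rs hw
    have hxm : x ∈ maximalIdeal Q := by
      rw [← hm]; exact Ideal.subset_span (by simp)
    have hle : Ideal.span {x} ≤ maximalIdeal Q := by
      rw [Ideal.span_le]; simpa using hxm
    have hnt : Nontrivial (Q ⧸ Ideal.span {x}) := Ideal.Quotient.nontrivial_iff.2
      (fun h => (maximalIdeal.isMaximal Q).ne_top (top_le_iff.1 (h ▸ hle)))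
    have hs : Function.Surjective (algebraMap Q (Q ⧸ Ideal.span {x})) := Ideal.Quotient.mk_surjective
    have hloc : IsLocalRing (Q ⧸ Ideal.span {x}) := IsLocalRing.of_surjective' _ hs
    have hmax : Ideal.ofList (rs.map (algebraMap Q (Q ⧸ Ideal.span {x}))) =
        maximalIdeal (Q ⧸ Ideal.span {x}) := by
      have h1 : Ideal.map (algebraMap Q (Q ⧸ Ideal.span {x})) (maximalIdeal Q) =
          Ideal.ofList (rs.map (algebraMap Q (Q ⧸ Ideal.span {x}))) := by
        rw [← hm, Ideal.ofList_cons, Ideal.map_sup, Ideal.map_ofList, Ideal.map_span]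
        simp
      rw [← h1]
      apply IsLocalRing.eq_maximalIdeal
      apply (Ideal.map_eq_top_or_isMaximal_of_surjective _ hs (maximalIdeal.isMaximal Q)).resolve_left
      intro h
      rw [Ideal.eq_top_iff_one, Ideal.mem_map_iff_of_surjective _ hs] at h
      obtain ⟨a, ha, ha1⟩ := h
      have : a - 1 ∈ maximalIdeal Q := hle (by
        rw [← Ideal.Quotient.eq_zero_iff_mem, map_sub, map_one]
        rw [sub_eq_zero]; exact ha1)
      have h3 : (1 : Q) ∈ maximalIdeal Q := by
        simpa using sub_mem ha this
      exact (maximalIdeal.isMaximal Q).ne_top ((Ideal.eq_top_iff_one _).2 h3)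
    have ih' := ih (Q ⧸ Ideal.span {x}) _ (by simpa using hrs) hw' hmax
    have hk := quot_mk_ker x
    have reg : ∀ (L N : Type) [AddCommGroup L] [Module Q L] [AddCommGroup N] [Module Q N]
      [Module.Finite Q L] [Module.Finite Q N] (_ : IsSMulRegular L x) (_ : IsSMulRegular N x)
      (i : ℕ), n < i → EV Q L N i := by
      intro L N _ _ _ _ _ _ hL hN i hi
      refine EV.nakayama x hxm (SES.mulx hs x hk N hN) i ?_
      obtain ⟨i, rfl⟩ : ∃ k, i = k + 1 := ⟨i - 1, by omega⟩
      refine (KL hs x hk hx i L _ _ (SES.mulx hs x hk L hL).surj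
        (fun l => tens_ker hs x hk L l) hL _).2 ?_
      exact ih' _ _ _ hi
    obtain ⟨r, g, hg⟩ := exists_syz Q M
    obtain ⟨r', g', hg'⟩ := exists_syz Q N
    have hsub : ∀ {r : ℕ} (S : Submodule Q (Fin r → Q)), IsSMulRegular S x := by
      intro r S a b hab
      exact Subtype.ext (fin_reg x hx r (congrArg Subtype.val hab))
    obtain ⟨i, rfl⟩ : ∃ k, i = k + 1 := ⟨i - 1, by omega⟩
    rw [EV.shift (SES.ker g hg) i (by omega)]
    exact EV.cov_right (SES.ker g' hg') (reg _ _ (hsub _) (fin_reg x hx _) _ (by omega))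
      (reg _ _ (hsub _) (hsub _) _ (by omega))

theorem EV.iso {B A : Type} [CommRing B] [CommRing A] [Algebra B A]
    (hb : Function.Bijective (algebraMap B A)) (i : ℕ) :
    ∀ (M : Type) [AddCommGroup M] [Module A M] [Module B M] [IsScalarTower B A M]
    (N : Type) [AddCommGroup N] [Module A N] [Module B N] [IsScalarTower B A N],
    EV A M N (i + 1) ↔ EV B M N (i + 1) := by
  have hfree : Module.Free B A :=
    Module.Free.of_equiv (LinearEquiv.ofBijective (Algebra.linearMap B A) hb)
  induction i with
  | zero =>
    intro M _ _ _ _ N _ _ _ _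
    let p : (M →₀ A) →ₗ[A] M := Finsupp.linearCombination A id
    have hp : Function.Surjective p := Finsupp.linearCombination_id_surjective A M
    have S1 := SES.ker p hp
    let ι : LinearMap.ker p →ₗ[B] (M →₀ A) := LinearMap.restrictScalars B (LinearMap.ker p).subtype
    have S2 : SES (X := LinearMap.ker p) ι (LinearMap.restrictScalars B p) :=
      ⟨S1.inj, S1.surj, fun t => S1.exact t⟩
    constructor
    · intro h
      refine EV.of_extend S2 (EV.of_proj _ le_rfl) fun φ => ?_
      obtain ⟨ψ, hψ⟩ := EV.extend S1 h (LinearMap.extendScalarsOfSurjective hb.2 φ)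
      exact ⟨LinearMap.restrictScalars B ψ, LinearMap.ext fun t => LinearMap.congr_fun hψ t⟩
    · intro h
      refine EV.of_extend S1 (EV.of_proj _ le_rfl) fun φ => ?_
      obtain ⟨ψ, hψ⟩ := EV.extend S2 h (LinearMap.restrictScalars B φ)
      exact ⟨LinearMap.extendScalarsOfSurjective hb.2 ψ,
        LinearMap.ext fun t => LinearMap.congr_fun hψ t⟩
  | succ i ih =>
    intro M _ _ _ _ N _ _ _ _
    let p : (M →₀ A) →ₗ[A] M := Finsupp.linearCombination A id
    have hp : Function.Surjective p := Finsupp.linearCombination_id_surjective A M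
    have S1 := SES.ker p hp
    let ι : LinearMap.ker p →ₗ[B] (M →₀ A) := LinearMap.restrictScalars B (LinearMap.ker p).subtype
    have S2 : SES (X := LinearMap.ker p) ι (LinearMap.restrictScalars B p) :=
      ⟨S1.inj, S1.surj, fun t => S1.exact t⟩
    rw [EV.shift S1 _ (by omega), EV.shift S2 _ (by omega)]
    exact ih _ _

theorem PB.iso {B A : Type} [CommRing B] [CommRing A] [Algebra B A]
    (hb : Function.Bijective (algebraMap B A)) (b : ℕ) (h : PB B b) : PB A b := by
  have : Module.Finite B A := Module.Finite.of_surjective (Algebra.linearMap B A) hb.2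
  refine ⟨?_, ?_⟩
  · intro M N _ _ _ _ _ _ ⟨n₀, hn⟩ i hi
    let _ : Module B M := Module.compHom M (algebraMap B A)
    let _ : Module B N := Module.compHom N (algebraMap B A)
    have : IsScalarTower B A M := ⟨fun a b c => by
      rw [Algebra.smul_def, mul_smul]; rfl⟩
    have : IsScalarTower B A N := ⟨fun a b c => by
      rw [Algebra.smul_def, mul_smul]; rfl⟩
    have : Module.Finite B M := Module.Finite.trans A M
    have : Module.Finite B N := Module.Finite.trans A N
    obtain ⟨i, rfl⟩ : ∃ k, i = k + 1 := ⟨i - 1, by omega⟩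
    rw [EV.iso hb]
    refine h.ab M N ⟨n₀ + 1, fun j hj => ?_⟩ _ hi
    obtain ⟨j, rfl⟩ : ∃ k, j = k + 1 := ⟨j - 1, by omega⟩
    rw [← EV.iso hb]
    exact hn _ (by omega)
  · intro M _ _ _ i hi
    let _ : Module B M := Module.compHom M (algebraMap B A)
    have : IsScalarTower B A M := ⟨fun a b c => by
      rw [Algebra.smul_def, mul_smul]; rfl⟩
    have : Module.Finite B M := Module.Finite.trans A M
    obtain ⟨i, rfl⟩ : ∃ k, i = k + 1 := ⟨i - 1, by omega⟩
    rw [EV.iso hb]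
    exact EV.congr_right (LinearEquiv.ofBijective (Algebra.linearMap B A) hb) (h.gor M _ hi)

theorem PB.tower (b n : ℕ) : ∀ (B C : Type) [CommRing B] [CommRing C] [Algebra B C] (gs : List B),
    gs.length = n → PB B b → RingTheory.Sequence.IsWeaklyRegular B gs →
    Function.Surjective (algebraMap B C) →
    RingHom.ker (algebraMap B C) = Ideal.ofList gs → PB C b := by
  induction n with
  | zero =>
    intro B C _ _ _ gs hl h hw hs hker
    rw [List.length_eq_zero_iff] at hl
    subst hl
    rw [Ideal.ofList_nil] at hker
    exact PB.iso ⟨(RingHom.injective_iff_ker_eq_bot _).2 hker, hs⟩ b h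
  | succ n ih =>
    intro B C _ _ _ gs hl h hw hs hker
    obtain ⟨x, rs, rfl⟩ := List.exists_cons_of_length_eq_add_one hl
    obtain ⟨hx, hw'⟩ := weak_cons x rs hw
    have h' : PB (B ⧸ Ideal.span {x}) b :=
      PB.descend Ideal.Quotient.mk_surjective x (quot_mk_ker x) hx b h
    have hxk : ∀ a ∈ Ideal.span {x}, algebraMap B C a = 0 := by
      intro a ha
      rw [← RingHom.mem_ker, hker, Ideal.ofList_cons]
      exact Ideal.mem_sup_left ha
    let _ : Algebra (B ⧸ Ideal.span {x}) C :=
      (Ideal.Quotient.lift (Ideal.span {x}) (algebraMap B C) hxk).toAlgebra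
    have hmk : ∀ a : B, algebraMap (B ⧸ Ideal.span {x}) C (Ideal.Quotient.mk _ a) =
      algebraMap B C a := fun a => rfl
    refine ih (B ⧸ Ideal.span {x}) C _ (by simpa using hl) h' hw' ?_ ?_
    · intro c
      obtain ⟨a, rfl⟩ := hs c
      exact ⟨Ideal.Quotient.mk _ a, rfl⟩
    · rw [← Ideal.map_ofList, Ideal.Quotient.algebraMap_eq]
      ext y
      obtain ⟨a, rfl⟩ := Ideal.Quotient.mk_surjective y
      rw [RingHom.mem_ker, hmk, ← RingHom.mem_ker, hker, Ideal.ofList_cons,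
        Ideal.mem_map_iff_of_surjective _ Ideal.Quotient.mk_surjective]
      constructor
      · intro ha
        obtain ⟨u, hu, v, hv, rfl⟩ := Submodule.mem_sup.1 ha
        refine ⟨v, hv, ?_⟩
        rw [map_add, Ideal.Quotient.eq_zero_iff_mem.2 hu, zero_add]
      · rintro ⟨v, hv, hva⟩
        have : a - v ∈ Ideal.span {x} := by
          rw [← Ideal.Quotient.eq_zero_iff_mem, map_sub, sub_eq_zero]; exact hva.symm
        rw [← sub_add_cancel a v]
        exact add_mem (Ideal.mem_sup_left this) (Ideal.mem_sup_right hv)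

theorem PB.final (Q : Type) [CommRing Q] [IsLocalRing Q] [IsNoetherianRing Q]
    (hQreg : IsRegularLocal Q) (d : ℕ) (g : Fin d → Q)
    (hgreg : RingTheory.Sequence.IsRegular Q (List.ofFn g))
    (J : Ideal Q) (hJg : J = Ideal.span (Set.range g)) : ∃ b, PB (Q ⧸ J) b := by
  obtain ⟨rs, hrs, hm⟩ := hQreg
  have hb := base_bound rs.length Q rs rfl hrs.toIsWeaklyRegular hm
  refine ⟨rs.length, PB.tower rs.length _ Q (Q ⧸ J) (List.ofFn g) rfl
    ⟨fun M N _ _ _ _ _ _ _ i hi => hb M N i hi, fun M _ _ _ i hi => hb M Q i hi⟩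
    hgreg.toIsWeaklyRegular Ideal.Quotient.mk_surjective ?_⟩
  rw [Ideal.Quotient.algebraMap_eq, Ideal.mk_ker, hJg]
  congr 1
  ext y
  simp [List.mem_ofFn]

end BaseRing

section MainProof

open CategoryTheory.Abelian TensorProduct

theorem SES.dual {A : Type} [CommRing A] {X Y Z : Type} [AddCommGroup X] [Module A X]
    [AddCommGroup Y] [Module A Y] [AddCommGroup Z] [Module A Z]
    {f : X →ₗ[A] Y} {g : Y →ₗ[A] Z} (h : SES f g) (hE : EV A Z A 1) :
    SES g.dualMap f.dualMap := by
  refine ⟨LinearMap.dualMap_injective_of_surjective h.surj, ?_, ?_⟩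
  · intro φ
    obtain ⟨ψ, hψ⟩ := EV.extend h hE φ
    exact ⟨ψ, hψ⟩
  · intro φ
    constructor
    · intro hφ
      obtain ⟨ψ, hψ⟩ := LinearMap.exists_factor' g h.surj φ (fun y hy => by
        obtain ⟨x, rfl⟩ := (h.exact y).1 hy
        exact LinearMap.congr_fun hφ x)
      exact ⟨ψ, hψ⟩
    · rintro ⟨ψ, rfl⟩
      ext x
      show ψ (g (f x)) = 0
      rw [(h.exact (f x)).2 ⟨x, rfl⟩, map_zero]

/-- A resolution by finite free modules, with all syzygies. -/
structure Res (A : Type) [CommRing A] (T : Type) [AddCommGroup T] [Module A T] where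
  K : ℕ → ModuleCat.{0} A
  fin : ∀ j, Module.Finite A (K j)
  r : ℕ → ℕ
  ι : ∀ j, K (j + 1) →ₗ[A] (Fin (r j) → A)
  π : ∀ j, (Fin (r j) → A) →ₗ[A] K j
  ses : ∀ j, SES (ι j) (π j)
  e : K 0 ≃ₗ[A] T

theorem Res.exists (A : Type) [CommRing A] [IsNoetherianRing A] (T : Type) [AddCommGroup T]
    [Module A T] [Module.Finite A T] : Nonempty (Res A T) := by
  have H : ∀ X : {X : ModuleCat.{0} A // Module.Finite A X},
      ∃ (r : ℕ) (g : (Fin r → A) →ₗ[A] X.1), Function.Surjective g := fun X => by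
    have := X.2
    exact exists_syz A X.1
  choose r g hg using H
  let F : ℕ → {X : ModuleCat.{0} A // Module.Finite A X} := fun n =>
    Nat.rec ⟨ModuleCat.of A T, inferInstanceAs (Module.Finite A T)⟩
      (fun _ X => ⟨ModuleCat.of A (LinearMap.ker (g X)),
        inferInstanceAs (Module.Finite A (LinearMap.ker (g X)))⟩) n
  exact ⟨{
    K := fun j => (F j).1
    fin := fun j => (F j).2
    r := fun j => r (F j)
    ι := fun j => (LinearMap.ker (g (F j))).subtype
    π := fun j => g (F j)
    ses := fun j => SES.ker (g (F j)) (hg (F j))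
    e := LinearEquiv.refl A T }⟩

variable {A : Type} [CommRing A]
variable {T : Type} [AddCommGroup T] [Module A T]
variable {W : Type} [AddCommGroup W] [Module A W]

theorem Res.shift (R : Res A T) (i j : ℕ) (hi : 1 ≤ i) :
    EV A T W (i + j) ↔ EV A (R.K j) W i := by
  induction j generalizing i with
  | zero => exact ⟨EV.congr_left R.e.symm, EV.congr_left R.e⟩
  | succ j ih =>
    have : i + (j + 1) = (i + 1) + j := by omega
    rw [this, ih (i + 1) (by omega), EV.shift (R.ses j) i hi]

/-- dual sequences shift -/
theorem Res.dshift (R : Res A T) (a : ℕ) (hR : ∀ j, a ≤ j → EV A (R.K j) A 1) (j k i : ℕ)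
    (hj : a ≤ j) (hi : 1 ≤ i) :
    EV A (Module.Dual A (R.K (j + k))) W (i + k) ↔ EV A (Module.Dual A (R.K j)) W i := by
  induction k with
  | zero => exact Iff.rfl
  | succ k ih =>
    rw [← ih]
    exact EV.shift ((R.ses (j + k)).dual (hR _ (by omega))) (i + k) (by omega)

theorem free_reflexive (n : ℕ) (θ : Module.Dual A (Module.Dual A (Fin n → A))) :
    ∃ g : Fin n → A, ∀ f : Module.Dual A (Fin n → A), θ f = f g := by
  obtain ⟨g, rfl⟩ := (Module.evalEquiv A (Fin n → A)).surjective θ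
  exact ⟨g, fun f => rfl⟩

theorem torsionless {X : Type} [AddCommGroup X] [Module A X] {n : ℕ} (ι : X →ₗ[A] (Fin n → A))
    (hι : Function.Injective ι) (x : X) (hx : ∀ f : Module.Dual A X, f x = 0) : x = 0 := by
  apply hι
  rw [map_zero]
  ext i
  exact hx (LinearMap.proj i ∘ₗ ι)

theorem Res.reflexive (R : Res A T) (j : ℕ) (hE : EV A (R.K (j + 1)) A 1)
    (φ : Module.Dual A (Module.Dual A (R.K (j + 2)))) :
    ∃ y : R.K (j + 2), ∀ f, φ f = f y := by
  have S := R.ses (j + 1)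
  obtain ⟨g, hg⟩ := free_reflexive _ (φ ∘ₗ (R.ι (j + 1)).dualMap)
  have h0 : R.π (j + 1) g = 0 := by
    apply torsionless (R.ι j) (R.ses j).inj
    intro f
    have := hg (f ∘ₗ R.π (j + 1))
    rw [LinearMap.comp_apply] at this
    rw [LinearMap.comp_apply] at this
    rw [← this]
    have h2 : (R.ι (j + 1)).dualMap (f ∘ₗ R.π (j + 1)) = 0 := by
      ext x
      show f (R.π (j + 1) (R.ι (j + 1) x)) = 0
      rw [(S.exact _).2 ⟨x, rfl⟩, map_zero]
    rw [h2, map_zero]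
  obtain ⟨y, rfl⟩ := (S.exact _).1 h0
  refine ⟨y, fun f => ?_⟩
  obtain ⟨h, rfl⟩ := (S.dual hE).surj f
  exact hg h

theorem Res.reflEquiv (R : Res A T) (j : ℕ) (hE : EV A (R.K (j + 1)) A 1) :
    Nonempty (R.K (j + 2) ≃ₗ[A] Module.Dual A (Module.Dual A (R.K (j + 2)))) := by
  refine ⟨LinearEquiv.ofBijective (Module.Dual.eval A (R.K (j + 2))) ⟨?_, ?_⟩⟩
  · rw [injective_iff_map_eq_zero]
    intro x hx
    exact torsionless (R.ι (j + 1)) (R.ses (j + 1)).inj x (fun f => LinearMap.congr_fun hx f)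
  · intro φ
    obtain ⟨y, hy⟩ := R.reflexive j hE φ
    exact ⟨y, LinearMap.ext fun f => (hy f).symm⟩

theorem Res.dualE1 (R : Res A T) (j : ℕ) (hE : EV A (R.K (j + 1)) A 1)
    (hE2 : EV A (R.K (j + 2)) A 1) : EV A (Module.Dual A (R.K (j + 3))) A 1 := by
  refine EV.of_extend ((R.ses (j + 2)).dual hE2) (EV.of_proj _ le_rfl) fun φ => ?_
  obtain ⟨y, hy⟩ := R.reflexive j hE φ
  obtain ⟨g, rfl⟩ := (R.ses (j + 2)).surj y
  refine ⟨Module.Dual.eval A _ g, LinearMap.ext fun f => ?_⟩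
  rw [hy f]
  rfl

theorem PB.res {b : ℕ} (h : PB A b) [Module.Finite A T] (R : Res A T) (j : ℕ) (hj : b ≤ j)
    (i : ℕ) (hi : 1 ≤ i) : EV A (R.K j) A i :=
  (R.shift i j hi).1 (h.gor T _ (by omega))

theorem finite_dual [IsNoetherianRing A] (X : Type) [AddCommGroup X] [Module A X]
    [Module.Finite A X] : Module.Finite A (Module.Dual A X) := by
  obtain ⟨n, g, hg⟩ := exists_syz A X
  exact Module.Finite.of_injective g.dualMap (LinearMap.dualMap_injective_of_surjective hg)

theorem PB.dualG {b : ℕ} (h : PB A b) [IsNoetherianRing A] [Module.Finite A T] (R : Res A T)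
    (i : ℕ) (hi : 1 ≤ i) : EV A (Module.Dual A (R.K (2 * b + 3))) A i := by
  have := R.fin (2 * b + 3)
  have := finite_dual (A := A) (R.K (2 * b + 3))
  rcases Nat.lt_or_ge b i with hb | hb
  · exact h.gor _ i hb
  · have h1 := R.dualE1 (2 * b + 1 - i) (h.res R _ (by omega) 1 le_rfl)
      (h.res R _ (by omega) 1 le_rfl)
    have h2 := (R.dshift (W := A) b (fun j hj => h.res R j hj 1 le_rfl)
      (2 * b + 1 - i + 3) (i - 1) 1 (by omega) le_rfl).2 h1
    have e1 : 2 * b + 1 - i + 3 + (i - 1) = 2 * b + 3 := by omega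
    have e2 : 1 + (i - 1) = i := by omega
    rw [e1, e2] at h2
    exact h2

/-- `G ⊗ N ≃ Hom(G^*, N)` -/
theorem hat_exists (n : ℕ) (N : Type) [AddCommGroup N] [Module A N] :
    ∃ E : (Fin n → A) ⊗[A] N ≃ₗ[A] (Module.Dual A (Fin n → A) →ₗ[A] N),
      ∀ u f, E u f = TensorProduct.lid A N (f.rTensor N u) := by
  refine ⟨(TensorProduct.congr (Module.evalEquiv A (Fin n → A)) (LinearEquiv.refl A N)) ≪≫ₗ
    dualTensorHomEquiv A (Module.Dual A (Fin n → A)) N, ?_⟩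
  intro u f
  induction u with
  | zero => simp
  | tmul g n => simp
  | add s t hs ht => rw [map_add, LinearMap.add_apply, hs, ht, map_add, map_add]

theorem Res.tensInj (R : Res A T) (hR : ∀ j, EV A (R.K j) A 1)
    (N : Type) [AddCommGroup N] [Module A N]
    (hN : ∀ j, EV A (Module.Dual A (R.K j)) N 1) (j : ℕ) :
    Function.Injective ((R.ι j).rTensor N) := by
  rw [injective_iff_map_eq_zero]
  intro t ht
  obtain ⟨u, rfl⟩ := LinearMap.rTensor_surjective N (R.ses (j + 1)).surj t
  obtain ⟨E1, hE1⟩ := hat_exists (A := A) (R.r (j + 1)) N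
  obtain ⟨E2, hE2⟩ := hat_exists (A := A) (R.r (j + 2)) N
  have S0 := (R.ses j).dual (hR j)
  have S1 := (R.ses (j + 1)).dual (hR (j + 1))
  have S2 := (R.ses (j + 2)).dual (hR (j + 2))
  have hu : ∀ f : Module.Dual A (R.K (j + 1)), E1 u ((R.π (j + 1)).dualMap f) = 0 := by
    intro f
    obtain ⟨h, rfl⟩ := S0.surj f
    rw [hE1]
    have : (R.π (j + 1)).dualMap ((R.ι j).dualMap h) = h ∘ₗ R.ι j ∘ₗ R.π (j + 1) := rfl
    rw [this, LinearMap.rTensor_comp, LinearMap.rTensor_comp, LinearMap.comp_apply,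
      LinearMap.comp_apply, ht, map_zero, map_zero]
  obtain ⟨v, hv⟩ := LinearMap.exists_factor' (R.ι (j + 1)).dualMap S1.surj (E1 u) (fun f hf => by
    obtain ⟨f', rfl⟩ := (S1.exact f).1 hf
    exact hu f')
  obtain ⟨w, hw⟩ := EV.extend S2 (hN (j + 3)) v
  obtain ⟨w', rfl⟩ := E2.surjective w
  have hfin : u = (R.ι (j + 1)).rTensor N ((R.π (j + 2)).rTensor N w') := by
    apply E1.injective
    apply LinearMap.ext
    intro f
    rw [← hv, ← hw, LinearMap.comp_apply, LinearMap.comp_apply, hE2, hE1]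
    have : (R.π (j + 2)).dualMap ((R.ι (j + 1)).dualMap f) = f ∘ₗ R.ι (j + 1) ∘ₗ R.π (j + 2) := rfl
    rw [this, LinearMap.rTensor_comp, LinearMap.rTensor_comp, LinearMap.comp_apply,
      LinearMap.comp_apply]
  rw [hfin]
  generalize (R.π (j + 2)).rTensor N w' = z
  rw [← LinearMap.comp_apply, ← LinearMap.rTensor_comp]
  have : R.π (j + 1) ∘ₗ R.ι (j + 1) = 0 := by
    ext x
    exact ((R.ses (j + 1)).exact _).2 ⟨x, rfl⟩
  rw [this]
  simp

theorem EV.freeTens {n i : ℕ} {N : Type} [AddCommGroup N] [Module A N] (h : EV A N W i) :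
    EV A ((Fin n → A) ⊗[A] N) W i :=
  EV.congr_left ((TensorProduct.comm A _ _ ≪≫ₗ TensorProduct.piScalarRight A A N (Fin n)).symm)
    (h.pi_left n)

theorem EV.freeDual {n i : ℕ} {N : Type} [AddCommGroup N] [Module A N] (h : EV A N A i) :
    EV A N (Module.Dual A (Fin n → A)) i :=
  EV.congr_right ((Pi.basisFun A (Fin n)).toDualEquiv) (h.pi_right n)

end MainProof

section MainThm

open CategoryTheory.Abelian TensorProduct

variable {A : Type} [CommRing A]
variable {T : Type} [AddCommGroup T] [Module A T]

/-- Core step: from vanishing of `Ext(T^*, N)` to vanishing of `Ext(N, T^*)`. -/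
theorem core [IsNoetherianRing A] {b : ℕ} (h : PB A b) [Module.Finite A T] (R : Res A T)
    (hT : ∀ i, 1 ≤ i → EV A T A i) (N : Type) [AddCommGroup N] [Module A N] [Module.Finite A N]
    (hN : ∀ i, 1 ≤ i → EV A N A i)
    (hv : ∃ n₀, ∀ i, n₀ ≤ i → EV A (Module.Dual A T) N i) (i : ℕ) (hi : b < i) :
    EV A N (Module.Dual A T) i := by
  have hfin := R.fin
  have hRi : ∀ j i, 1 ≤ i → EV A (R.K j) A i := fun j i hi =>
    (R.shift i j hi).1 (hT _ (by omega))
  have hR : ∀ j, EV A (R.K j) A 1 := fun j => hRi j 1 le_rfl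
  have hE : ∀ j i, b < i → EV A (Module.Dual A (R.K j)) N i := by
    intro j i hi
    have := finite_dual (A := A) (R.K j)
    obtain ⟨n₀, hn⟩ := hv
    refine h.ab _ N ⟨n₀ + 1 + j, fun i hi => ?_⟩ i hi
    have h1 : EV A (Module.Dual A (R.K 0)) N (i - j) :=
      EV.congr_left R.e.dualMap (hn _ (by omega))
    have h2 := (R.dshift (W := N) 0 (fun j _ => hR j) 0 j (i - j) le_rfl (by omega)).2 h1
    rw [zero_add, Nat.sub_add_cancel (by omega)] at h2
    exact h2
  have hE1 : ∀ j, EV A (Module.Dual A (R.K j)) N 1 := fun j =>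
    (R.dshift (W := N) 0 (fun j _ => hR j) j b 1 (Nat.zero_le _) le_rfl).1 (hE _ _ (by omega))
  have ST : ∀ j, SES ((R.ι j).rTensor N) ((R.π j).rTensor N) := fun j =>
    ⟨R.tensInj hR N hE1 j, LinearMap.rTensor_surjective N (R.ses j).surj,
      rTensor_exact N (R.ses j).exact (R.ses j).surj⟩
  have hK0 : ∀ j i, 1 ≤ i → b < i + j → EV A (R.K j ⊗[A] N) A i := by
    intro j
    induction j with
    | zero => intro i _ hi; exact h.gor _ i hi
    | succ j ih =>
      intro i hi1 hi
      exact EV.contra_left (ST j) (EV.freeTens (hN i hi1)) (ih (i + 1) (by omega) (by omega))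
  have hL : ∀ j, b ≤ j → EV A N (Module.Dual A (R.K j)) 1 := by
    intro j hj
    refine EV.of_lift ((R.ses j).dual (hR j)) (EV.freeDual (hN 1 le_rfl)) fun φ => ?_
    obtain ⟨ψ, hψ⟩ := EV.extend (ST j) (hK0 j 1 le_rfl (by omega))
      (TensorProduct.lift φ.flip)
    refine ⟨(TensorProduct.curry ψ).flip, ?_⟩
    apply LinearMap.ext
    intro n
    apply LinearMap.ext
    intro x
    have := LinearMap.congr_fun hψ (x ⊗ₜ n)
    simpa using this
  have hdown : ∀ k j i, 1 ≤ i → EV A N (Module.Dual A (R.K (j + k))) i →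
      EV A N (Module.Dual A (R.K j)) (i + k) := by
    intro k
    induction k with
    | zero => intro j i _ h; exact h
    | succ k ih =>
      intro j i hi hh
      have h1 := EV.cov_left ((R.ses (j + k)).dual (hR _)) hh (EV.freeDual (hN (i + 1) (by omega)))
      have h2 := ih j (i + 1) (by omega) h1
      rw [show i + (k + 1) = i + 1 + k by omega]
      exact h2
  have h3 := hdown (i - 1) 0 1 le_rfl (by rw [zero_add]; exact hL _ (by omega))
  rw [show 1 + (i - 1) = i by omega] at h3
  exact EV.congr_right R.e.symm.dualMap h3

theorem symm_main [IsNoetherianRing A] {b : ℕ} (h : PB A b) (M N : Type) [AddCommGroup M]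
    [Module A M] [AddCommGroup N] [Module A N] [Module.Finite A M] [Module.Finite A N]
    (hv : ∃ n₀, ∀ i, n₀ ≤ i → EV A M N i) : ∃ n₀, ∀ i, n₀ ≤ i → EV A N M i := by
  obtain ⟨RM⟩ := Res.exists A M
  obtain ⟨RN⟩ := Res.exists A N
  have hfM := RM.fin
  have hfN := RN.fin
  obtain ⟨n₀, hn⟩ := hv
  have hMN : ∀ j i, n₀ + b + j ≤ i → EV A M (RN.K j) i := by
    intro j
    induction j with
    | zero => intro i hi; exact EV.congr_right RN.e.symm (hn i (by omega))
    | succ j ih =>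
      intro i hi
      obtain ⟨i, rfl⟩ : ∃ k, i = k + 1 := ⟨i - 1, by omega⟩
      exact EV.cov_left (RN.ses j) (ih i (by omega)) ((h.gor M (i + 1) (by omega)).pi_right _)
  have hN' : ∀ i, 1 ≤ i → EV A (RN.K b) A i := fun i hi => h.res RN b le_rfl i hi
  obtain ⟨e⟩ := RM.reflEquiv (2 * b + 1) (h.res RM _ (by omega) 1 le_rfl)
  have := finite_dual (A := A) (RM.K (2 * b + 3))
  obtain ⟨R⟩ := Res.exists A (Module.Dual A (RM.K (2 * b + 3)))
  have h1 := core h R (fun i hi => h.dualG RM i hi) (RN.K b) hN'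
    ⟨n₀ + b + b + 1, fun i hi => EV.congr_left e
      ((RM.shift i (2 * b + 3) (by omega)).1 (hMN b _ (by omega)))⟩
  have h2 : ∀ i, b < i → EV A (RN.K b) (RM.K (2 * b + 3)) i := fun i hi =>
    EV.congr_right e.symm (h1 i hi)
  have h3 : ∀ k j, k + j = 2 * b + 3 → ∀ i, b < i → EV A (RN.K b) (RM.K j) i := by
    intro k
    induction k with
    | zero => intro j hj i hi; rw [zero_add] at hj; subst hj; exact h2 i hi
    | succ k ih =>
      intro j hj i hi
      exact EV.cov_right (RM.ses j) ((hN' i (by omega)).pi_right _)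
        (ih (j + 1) (by omega) (i + 1) (by omega))
  refine ⟨2 * b + 1, fun i hi => ?_⟩
  have h4 := EV.congr_right RM.e (h3 (2 * b + 3) 0 rfl (i - b) (by omega))
  have h5 := (RN.shift (i - b) b (by omega)).2 h4
  rwa [Nat.sub_add_cancel (by omega)] at h5

end MainThm

theorem extInf_iff (A : Type) [CommRing A] (M N : Type) [AddCommGroup M] [AddCommGroup N]
    (mM : Module A M) (mN : Module A N) :
    extInf A M N mM mN ↔ ¬ ∃ n₀, ∀ i, n₀ ≤ i → EV A M N i := by
  unfold extInf
  constructor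
  · rintro h ⟨n₀, hn⟩
    obtain ⟨i, hi, hnt⟩ := h (n₀ + 1)
    have := (extMod_iff A M N i (by omega)).2 (hn i (by omega))
    exact not_subsingleton _ this
  · intro h n
    by_contra hc
    apply h
    refine ⟨n + 1, fun i hi => ?_⟩
    rw [← extMod_iff A M N i (by omega)]
    by_contra hns
    rw [not_subsingleton_iff_nontrivial] at hns
    exact hc ⟨i, by omega, hns⟩

/-- Symmetry: `V_R^d(M,N) = V_R^d(N,M)`, pointwise. -/
theorem statement4
    (Q : Type) [CommRing Q] [IsLocalRing Q] [IsNoetherianRing Q]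
    (hQreg : IsRegularLocal Q)
    (c : ℕ) (hc : 1 ≤ c) (f : Fin c → Q)
    (hfreg : RingTheory.Sequence.IsRegular Q (List.ofFn f))
    (I : Ideal Q) (hIf : I = Ideal.span (Set.range f))
    (hIsq : I ≤ maximalIdeal Q ^ 2)
    (M N : Type) [AddCommGroup M] [AddCommGroup N] [Module Q M] [Module Q N]
    [Module.Finite Q M] [Module.Finite Q N]
    (hM : Module.IsTorsionBySet Q M (I : Set Q))
    (hN : Module.IsTorsionBySet Q N (I : Set Q))
    (d : ℕ) (g : Fin d → Q)
    (hgreg : RingTheory.Sequence.IsRegular Q (List.ofFn g))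
    (hglin : LinIndepInV Q I g)
    (J : Ideal Q) (hJg : J = Ideal.span (Set.range g)) (hJI : J ≤ I)
 :
    extInf (Q ⧸ J) M N (modOver J hJI M hM) (modOver J hJI N hN) ↔
      extInf (Q ⧸ J) N M (modOver J hJI N hN) (modOver J hJI M hM) := by
  obtain ⟨b, hb⟩ := PB.final Q hQreg d g hgreg J hJg
  rw [extInf_iff, extInf_iff]
  let mM : Module (Q ⧸ J) M := modOver J hJI M hM
  let mN : Module (Q ⧸ J) N := modOver J hJI N hN
  have tM : IsScalarTower Q (Q ⧸ J) M := (hM.mono' hJI).isScalarTower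
  have tN : IsScalarTower Q (Q ⧸ J) N := (hN.mono' hJI).isScalarTower
  have fM : Module.Finite (Q ⧸ J) M := Module.Finite.of_restrictScalars_finite Q (Q ⧸ J) M
  have fN : Module.Finite (Q ⧸ J) N := Module.Finite.of_restrictScalars_finite Q (Q ⧸ J) N
  exact not_congr ⟨fun h => symm_main hb M N h, fun h => symm_main hb N M h⟩
end

section
/- Let M and N be finitely generated R-modules and let f ∈ I with f̄ ≠ 0 in V. Then Ext^i_{Q/(f)}(M,N) ≠ 0 for infinitely many i if and only if both Ext^i_{Q/(f)}(M,k) ≠ 0 for infinitely many i and Ext^i_{Q/(f)}(N,k) ≠ 0 for infinitely many i. (Equivalently, V_R^1(M,N) = V_R^1(M) ∩ V_R^1(N).) -/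
open CategoryTheory IsLocalRing

section ExtBridge

variable {A : Type} [CommRing A]

lemma oldExt_iff (X Y : ModuleCat.{0} A) (n : ℕ) :
    Subsingleton (((Ext A (ModuleCat A) (n + 1)).obj (Opposite.op X)).obj Y) ↔
      Subsingleton (Abelian.Ext.{0} X Y (n + 1)) := by
  let P := projectiveResolution X
  have h1 : Subsingleton (((Ext A (ModuleCat A) (n + 1)).obj (Opposite.op X)).obj Y) ↔
      ∀ f : P.complex.X (n + 1) ⟶ Y, P.complex.d (n + 2) (n + 1) ≫ f = 0 →
        ∃ g : P.complex.X n ⟶ Y, P.complex.d (n + 1) n ≫ g = f := by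
    rw [← ModuleCat.isZero_iff_subsingleton, (P.isoExt (n + 1) Y).isZero_iff,
      ← HomologicalComplex.exactAt_iff_isZero_homology,
      HomologicalComplex.exactAt_iff' _ n (n + 1) (n + 2) (by simp) (by simp),
      ShortComplex.moduleCat_exact_iff]
    rfl
  have h2 : Subsingleton (Abelian.Ext.{0} X Y (n + 1)) ↔
      ∀ f : P.complex.X (n + 1) ⟶ Y, P.complex.d (n + 2) (n + 1) ≫ f = 0 →
        ∃ g : P.complex.X n ⟶ Y, P.complex.d (n + 1) n ≫ g = f := by
    constructor
    · intro h f hf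
      exact (P.extMk_eq_zero_iff f (n + 2) rfl hf n rfl).1 (Subsingleton.elim _ _)
    · intro h
      refine subsingleton_of_forall_eq 0 fun α => ?_
      obtain ⟨f, hf, rfl⟩ := P.extMk_surjective α (n + 2) rfl
      exact (P.extMk_eq_zero_iff f (n + 2) rfl hf n rfl).2 (h f hf)
  rw [h1, h2]

variable {K F M Y : Type} [AddCommGroup K] [AddCommGroup F] [AddCommGroup M] [AddCommGroup Y]
  [mK : Module A K] [mF : Module A F] [mM : Module A M] [mY : Module A Y]

lemma ses_shortExact (i : K →ₗ[A] F) (p : F →ₗ[A] M) (hi : Function.Injective i)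
    (hp : Function.Surjective p) (hip : Function.Exact i p) :
    ∃ w, (ShortComplex.mk (ModuleCat.ofHom i) (ModuleCat.ofHom p) w).ShortExact := by
  have w : ModuleCat.ofHom i ≫ ModuleCat.ofHom p = 0 := by
    ext x
    exact hip.apply_apply_eq_zero x
  have h1 : Mono (ModuleCat.ofHom i) := (ModuleCat.mono_iff_injective _).2 hi
  have h2 : Epi (ModuleCat.ofHom p) := (ModuleCat.epi_iff_surjective _).2 hp
  refine ⟨w, { exact := ?_, mono_f := h1, epi_g := h2 }⟩
  rw [ShortComplex.ShortExact.moduleCat_exact_iff_function_exact]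
  exact hip

lemma V_succ [Module.Projective A F] (i : K →ₗ[A] F) (p : F →ₗ[A] M) (hi : Function.Injective i)
    (hp : Function.Surjective p) (hip : Function.Exact i p) (n : ℕ) :
    Subsingleton (extMod A M Y mM mY (n + 2)) ↔ Subsingleton (extMod A K Y mK mY (n + 1)) := by
  obtain ⟨w, hS⟩ := ses_shortExact i p hi hp hip
  refine (oldExt_iff (ModuleCat.of A M) (ModuleCat.of A Y) (n + 1)).trans
    (Iff.trans ?_ (oldExt_iff (ModuleCat.of A K) (ModuleCat.of A Y) n).symm)
  have hproj : Projective (ModuleCat.of A F) := (IsProjective.iff_projective _).1 inferInstance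
  have hs (m : ℕ) : Subsingleton (Abelian.Ext.{0} (ModuleCat.of A F) (ModuleCat.of A Y) (m + 1)) :=
    Abelian.Ext.subsingleton_of_projective _ _ m
  constructor
  · intro h
    refine subsingleton_of_forall_eq 0 fun x => ?_
    obtain ⟨x₂, rfl⟩ := Abelian.Ext.contravariant_sequence_exact₁ hS _ x (add_comm 1 (n + 1))
      (Subsingleton.elim (h := h) _ _)
    rw [Subsingleton.elim (h := hs n) x₂ 0, Abelian.Ext.comp_zero]
  · intro h
    refine subsingleton_of_forall_eq 0 fun x => ?_
    obtain ⟨x₂, rfl⟩ := Abelian.Ext.contravariant_sequence_exact₃ hS _ x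
      (Subsingleton.elim (h := hs (n + 1)) _ _) (add_comm 1 (n + 1))
    rw [Subsingleton.elim (h := h) x₂ 0, Abelian.Ext.comp_zero]

lemma V_one [Module.Projective A F] (i : K →ₗ[A] F) (p : F →ₗ[A] M) (hi : Function.Injective i)
    (hp : Function.Surjective p) (hip : Function.Exact i p) :
    Subsingleton (extMod A M Y mM mY 1) ↔ ∀ u : K →ₗ[A] Y, ∃ v : F →ₗ[A] Y, v ∘ₗ i = u := by
  obtain ⟨w, hS⟩ := ses_shortExact i p hi hp hip
  refine (oldExt_iff (ModuleCat.of A M) (ModuleCat.of A Y) 0).trans ?_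
  have hproj : Projective (ModuleCat.of A F) := (IsProjective.iff_projective _).1 inferInstance
  have hs (m : ℕ) : Subsingleton (Abelian.Ext.{0} (ModuleCat.of A F) (ModuleCat.of A Y) (m + 1)) :=
    Abelian.Ext.subsingleton_of_projective _ _ m
  constructor
  · intro h u
    obtain ⟨x₂, hx⟩ := Abelian.Ext.contravariant_sequence_exact₁ hS _
      (Abelian.Ext.mk₀ (ModuleCat.ofHom u)) (add_comm 1 0) (Subsingleton.elim (h := h) _ _)
    obtain ⟨v, rfl⟩ := (Abelian.Ext.mk₀_bijective _ _).2 x₂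
    rw [Abelian.Ext.mk₀_comp_mk₀, (Abelian.Ext.mk₀_bijective _ _).1.eq_iff] at hx
    refine ⟨v.hom, ?_⟩
    exact congrArg ModuleCat.Hom.hom hx
  · intro h
    refine subsingleton_of_forall_eq 0 fun x => ?_
    obtain ⟨x₁, rfl⟩ := Abelian.Ext.contravariant_sequence_exact₃ hS _ x
      (Subsingleton.elim (h := hs 0) _ _) (add_comm 1 0)
    obtain ⟨u, rfl⟩ := (Abelian.Ext.mk₀_bijective _ _).2 x₁
    obtain ⟨v, hv⟩ := h u.hom
    have : u = ModuleCat.ofHom i ≫ ModuleCat.ofHom v := by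
      ext x
      exact (LinearMap.congr_fun hv x).symm
    rw [this, ← Abelian.Ext.mk₀_comp_mk₀]
    exact hS.extClass_comp_assoc _

end ExtBridge

section PD

/-- Projective dimension `< n`, at the level of unbundled modules. -/
def PD (Q : Type) [CommRing Q] (X : Type) [AddCommGroup X] [Module Q X] (n : ℕ) : Prop :=
  HasProjectiveDimensionLT (ModuleCat.of Q X) n

variable {Q : Type} [CommRing Q]
variable {K F M : Type} [AddCommGroup K] [AddCommGroup F] [AddCommGroup M]
  [Module Q K] [Module Q F] [Module Q M]

lemma PD.mono {n m : ℕ} (h : PD Q M n) (hnm : n ≤ m) : PD Q M m :=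
  haveI : HasProjectiveDimensionLT (ModuleCat.of Q M) n := h
  hasProjectiveDimensionLT_of_ge (ModuleCat.of Q M) n m hnm

lemma PD_one_iff : PD Q M 1 ↔ Module.Projective Q M :=
  projective_iff_hasProjectiveDimensionLT_one.symm.trans
    (IsProjective.iff_projective (R := Q) M).symm

lemma PD.X₁ (i : K →ₗ[Q] F) (p : F →ₗ[Q] M) (hi : Function.Injective i)
    (hp : Function.Surjective p) (hip : Function.Exact i p) {n : ℕ}
    (h2 : PD Q F n) (h3 : PD Q M (n + 1)) : PD Q K n := by
  obtain ⟨w, hS⟩ := ses_shortExact i p hi hp hip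
  exact hS.hasProjectiveDimensionLT_X₁ n h2 h3

lemma PD.X₃ (i : K →ₗ[Q] F) (p : F →ₗ[Q] M) (hi : Function.Injective i)
    (hp : Function.Surjective p) (hip : Function.Exact i p) {n : ℕ}
    (h1 : PD Q K n) (h2 : PD Q F (n + 1)) : PD Q M (n + 1) := by
  obtain ⟨w, hS⟩ := ses_shortExact i p hi hp hip
  exact hS.hasProjectiveDimensionLT_X₃ n h1 h2

lemma PD.congr (e : K ≃ₗ[Q] M) {n : ℕ} (h : PD Q K n) : PD Q M n :=
  haveI : HasProjectiveDimensionLT (ModuleCat.of Q K) n := h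
  hasProjectiveDimensionLT_of_iso e.toModuleIso n

end PD

section GlobalDim

open RingTheory.Sequence Pointwise TensorProduct

variable {Q : Type} [CommRing Q]

lemma quotSMulTop_injective {K F M : Type} [AddCommGroup K] [AddCommGroup F] [AddCommGroup M]
    [Module Q K] [Module Q F] [Module Q M] (i : K →ₗ[Q] F) (p : F →ₗ[Q] M)
    (hi : Function.Injective i) (hip : Function.Exact i p) (x : Q) (hx : IsSMulRegular M x) :
    Function.Injective (QuotSMulTop.map x i) := by
  rw [← LinearMap.ker_eq_bot, LinearMap.ker_eq_bot']
  intro k hk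
  obtain ⟨k, rfl⟩ := Submodule.Quotient.mk_surjective _ k
  have hk' : (Submodule.Quotient.mk (i k) : QuotSMulTop x F) = 0 := hk
  rw [Submodule.Quotient.mk_eq_zero, Submodule.mem_smul_pointwise_iff_exists] at hk'
  obtain ⟨b, -, hb⟩ := hk'
  have hpb : p b = 0 := by
    apply hx
    change x • p b = x • 0
    rw [← map_smul, hb, hip.apply_apply_eq_zero, smul_zero]
  obtain ⟨k', rfl⟩ := (hip b).1 hpb
  rw [← map_smul] at hb
  rw [Submodule.Quotient.mk_eq_zero, ← hi hb]
  exact Submodule.smul_mem_pointwise_smul _ _ _ trivial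

lemma syzygy_regular (rs : List Q) : ∀ (i : ℕ) (K F M : Type) [AddCommGroup K] [AddCommGroup F]
    [AddCommGroup M] [Module Q K] [Module Q F] [Module Q M] (ι : K →ₗ[Q] F) (p : F →ₗ[Q] M)
    (_ : Function.Injective ι) (_ : Function.Surjective p) (_ : Function.Exact ι p)
    (_ : IsWeaklyRegular F rs) (_ : IsWeaklyRegular M (rs.take i)),
    IsWeaklyRegular K (rs.take (i + 1)) := by
  induction rs with
  | nil => intros; simp
  | cons x rs ih =>
    intro i K F M _ _ _ _ _ _ ι p hι hp hip hF hM
    rw [isWeaklyRegular_cons_iff] at hF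
    have hxK : IsSMulRegular K x := fun a b hab => by
      apply hι
      apply hF.1
      change x • ι a = x • ι b
      rw [← map_smul, ← map_smul]
      exact congrArg ι hab
    cases i with
    | zero =>
      simpa using hxK
    | succ i =>
      rw [List.take_succ_cons, isWeaklyRegular_cons_iff] at hM ⊢
      exact ⟨hxK, ih i _ _ _ (QuotSMulTop.map x ι) (QuotSMulTop.map x p)
        (quotSMulTop_injective ι p hι hip x hM.1) (QuotSMulTop.map_surjective x hp)
        (QuotSMulTop.map_exact x hip hp) hF.2 hM.2⟩

lemma inter_smul_of_regular (rs : List Q) : ∀ (K F M : Type) [AddCommGroup K] [AddCommGroup F]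
    [AddCommGroup M] [Module Q K] [Module Q F] [Module Q M] (ι : K →ₗ[Q] F) (p : F →ₗ[Q] M)
    (_ : Function.Injective ι) (_ : Function.Surjective p) (_ : Function.Exact ι p)
    (_ : IsWeaklyRegular M rs) (z : K) (_ : ι z ∈ Ideal.ofList rs • (⊤ : Submodule Q F)),
    z ∈ Ideal.ofList rs • (⊤ : Submodule Q K) := by
  induction rs with
  | nil =>
    intro K F M _ _ _ _ _ _ ι p hι hp hip hM z hz
    simp only [Ideal.ofList_nil, Submodule.bot_smul, Submodule.mem_bot] at hz ⊢
    exact hι (by rw [hz, map_zero])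
  | cons x rs ih =>
    intro K F M _ _ _ _ _ _ ι p hι hp hip hM z hz
    rw [isWeaklyRegular_cons_iff] at hM
    have key (L : Type) [AddCommGroup L] [Module Q L] (w : L) :
        w ∈ Ideal.ofList (x :: rs) • (⊤ : Submodule Q L) ↔
        (Submodule.Quotient.mk w : QuotSMulTop x L) ∈ Ideal.ofList rs •
          (⊤ : Submodule Q (QuotSMulTop x L)) := by
      have : (⊤ : Submodule Q (QuotSMulTop x L)) =
          Submodule.map (Submodule.mkQ (x • (⊤ : Submodule Q L))) ⊤ := by
        rw [Submodule.map_top, Submodule.range_mkQ]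
      rw [this, ← Submodule.map_smul'', ← Submodule.mkQ_apply, ← Submodule.mem_comap,
        Submodule.comap_map_mkQ, Ideal.ofList_cons_smul]
    rw [key] at hz ⊢
    exact ih _ _ _ (QuotSMulTop.map x ι) (QuotSMulTop.map x p)
        (quotSMulTop_injective ι p hι hip x hM.1) (QuotSMulTop.map_surjective x hp)
        (QuotSMulTop.map_exact x hip hp) hM.2 _ hz

variable [IsLocalRing Q] [IsNoetherianRing Q]

lemma free_of_regular (rs : List Q) (hrs : Ideal.ofList rs = maximalIdeal Q)
    (M : Type) [AddCommGroup M] [Module Q M] [Module.Finite Q M] (hM : IsWeaklyRegular M rs) :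
    Module.Projective Q M := by
  obtain ⟨m, p, hp⟩ := Module.Finite.exists_fin' Q M
  have hfree : Module.Free Q M := by
    refine Module.free_of_lTensor_residueField_injective (LinearMap.ker p).subtype p hp
      (LinearMap.exact_subtype_ker_map p) ?_
    rw [← LinearMap.ker_eq_bot, LinearMap.ker_eq_bot']
    intro t ht
    obtain ⟨z, rfl⟩ : ∃ z : LinearMap.ker p, (1 : ResidueField Q) ⊗ₜ[Q] z = t := by
      exact TensorProduct.mk_surjective Q (LinearMap.ker p) (ResidueField Q)
        IsLocalRing.residue_surjective t
    have key (L : Type) [AddCommGroup L] [Module Q L] (w : L) :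
        (1 : ResidueField Q) ⊗ₜ[Q] w = 0 ↔ w ∈ Ideal.ofList rs • (⊤ : Submodule Q L) := by
      rw [hrs, ← Submodule.Quotient.mk_eq_zero,
        ← TensorProduct.quotTensorEquivQuotSMul_mk_one_tmul, LinearEquiv.map_eq_zero_iff]
      rfl
    rw [LinearMap.lTensor_tmul, key] at ht
    rw [key]
    exact inter_smul_of_regular rs _ _ M (LinearMap.ker p).subtype p
      (Submodule.subtype_injective _) hp (LinearMap.exact_subtype_ker_map p) hM z ht
  infer_instance

lemma globalDim (rs : List Q) (hreg : IsWeaklyRegular Q rs)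
    (hrs : Ideal.ofList rs = maximalIdeal Q) (j : ℕ) :
    ∀ (i : ℕ) (_ : i + j = rs.length) (M : Type) [AddCommGroup M] [Module Q M] [Module.Finite Q M]
      (_ : IsWeaklyRegular M (rs.take i)), PD Q M (j + 1) := by
  induction j with
  | zero =>
    intro i hi M _ _ _ hM
    rw [List.take_of_length_le (by omega)] at hM
    exact PD_one_iff.2 (free_of_regular rs hrs M hM)
  | succ j ih =>
    intro i hi M _ _ _ hM
    obtain ⟨m, p, hp⟩ := Module.Finite.exists_fin' Q M
    have hF : IsWeaklyRegular (Fin m → Q) rs :=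
      ((TensorProduct.lid Q (Fin m → Q)).isWeaklyRegular_congr rs).1
        hreg.isWeaklyRegular_rTensor
    have := syzygy_regular rs i (LinearMap.ker p) (Fin m → Q) M (LinearMap.ker p).subtype p
      (Submodule.subtype_injective _) hp (LinearMap.exact_subtype_ker_map p) hF hM
    exact PD.X₃ (LinearMap.ker p).subtype p
      (Submodule.subtype_injective _) hp (LinearMap.exact_subtype_ker_map p)
      (ih (i + 1) (by omega) _ this) ((PD_one_iff.2 inferInstance).mono (by omega))

lemma exists_PD (hQ : IsRegularLocal Q) : ∃ n, ∀ (M : Type) [AddCommGroup M] [Module Q M]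
    [Module.Finite Q M], PD Q M n := by
  obtain ⟨rs, h1, h2⟩ := hQ
  exact ⟨rs.length + 1, fun M _ _ _ => globalDim rs h1.toIsWeaklyRegular h2 rs.length 0 (by simp) M
    (by simp)⟩

end GlobalDim

section RegularElement

open RingTheory.Sequence Pointwise

variable {Q : Type} [CommRing Q] [IsLocalRing Q]

lemma exists_perm_unit (rs : List Q) : ∀ (f₀ : Q) (_ : f₀ ∈ Ideal.ofList rs)
    (_ : f₀ ∉ maximalIdeal Q * Ideal.ofList rs),
    ∃ (x : Q) (rs' : List Q) (a b : Q), rs.Perm (x :: rs') ∧ IsUnit a ∧ b ∈ Ideal.ofList rs' ∧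
      f₀ = a * x + b := by
  induction rs with
  | nil =>
    intro f₀ h1 h2
    simp only [Ideal.ofList_nil, Ideal.mem_bot] at h1
    exact absurd (h1 ▸ zero_mem _) h2
  | cons y rs ih =>
    intro f₀ h1 h2
    rw [Ideal.ofList_cons, Submodule.mem_sup] at h1
    obtain ⟨z, hz, b, hb, rfl⟩ := h1
    obtain ⟨a, rfl⟩ := Ideal.mem_span_singleton'.1 hz
    by_cases ha : IsUnit a
    · exact ⟨y, rs, a, b, List.Perm.refl _, ha, hb, rfl⟩
    · have ha' : a ∈ maximalIdeal Q := (mem_maximalIdeal a).2 ha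
      have hb2 : b ∉ maximalIdeal Q * Ideal.ofList rs := by
        intro hb'
        apply h2
        refine add_mem (Ideal.mul_mem_mul ha' ?_) (Ideal.mul_mono_right ?_ hb')
        · rw [Ideal.ofList_cons]
          exact Ideal.mem_sup_left (Ideal.mem_span_singleton_self y)
        · rw [Ideal.ofList_cons]
          exact le_sup_right
      obtain ⟨x, rs', a', b', hp, ha', hb', rfl⟩ := ih b hb hb2
      refine ⟨x, y :: rs', a', b' + a * y, (hp.cons y).trans (List.Perm.swap x y rs'), ha', ?_,
        by ring⟩
      rw [Ideal.ofList_cons]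
      exact add_mem (Ideal.mem_sup_right hb')
        (Ideal.mem_sup_left (Ideal.mul_mem_left _ _ (Ideal.mem_span_singleton_self y)))

lemma regular_of_mem [IsNoetherianRing Q] (rs : List Q) (h : IsWeaklyRegular Q rs)
    (hrs : ∀ r ∈ rs, r ∈ maximalIdeal Q) (f₀ : Q) (h1 : f₀ ∈ Ideal.ofList rs)
    (h2 : f₀ ∉ maximalIdeal Q * Ideal.ofList rs) : IsSMulRegular Q f₀ := by
  obtain ⟨x, rs', a, b, hp, ha, hb, rfl⟩ := exists_perm_unit rs f₀ h1 h2
  have hp' : rs.Perm (rs' ++ [x]) := hp.trans (List.perm_append_singleton x rs').symm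
  have hf₀ : a * x + b ∈ maximalIdeal Q := by
    refine (Ideal.span_le.2 ?_ : Ideal.ofList rs ≤ _) h1
    exact fun r hr => hrs r hr
  have h3 := isWeaklyRegular_of_perm_of_subset_maximalIdeal h hp' hrs
  rw [isWeaklyRegular_append_iff, isWeaklyRegular_singleton_iff] at h3
  have h4 : IsWeaklyRegular Q (rs' ++ [a * x + b]) := by
    rw [isWeaklyRegular_append_iff, isWeaklyRegular_singleton_iff]
    refine ⟨h3.1, ?_⟩
    have key : ∀ y : Q ⧸ (Ideal.ofList rs' • ⊤ : Submodule Q Q), (a * x + b) • y = a • x • y := by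
      intro y
      obtain ⟨y, rfl⟩ := Submodule.Quotient.mk_surjective _ y
      rw [add_smul, mul_smul]
      conv_rhs => rw [← add_zero (a • x • _)]
      congr 1
      rw [← Submodule.Quotient.mk_smul, Submodule.Quotient.mk_eq_zero]
      exact Submodule.smul_mem_smul hb trivial
    intro y z hyz
    simp only [key] at hyz
    exact h3.2 (ha.smul_left_cancel.1 hyz)
  have h5 := isWeaklyRegular_of_perm_of_subset_maximalIdeal h4
    (List.perm_append_singleton (a * x + b) rs') (by
      intro r hr
      rcases List.mem_append.1 hr with hr | hr
      · exact hrs r (hp.mem_iff.2 (List.mem_cons_of_mem _ hr))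
      · rw [List.mem_singleton.1 hr]; exact hf₀)
  exact ((isWeaklyRegular_cons_iff _ _ _).1 h5).1

end RegularElement

/-- Matrix factorizations of `f`, coordinate free. -/
structure MF (Q : Type) [CommRing Q] (f : Q) where
  F : Type
  G : Type
  [acF : AddCommGroup F]
  [acG : AddCommGroup G]
  [modF : Module Q F]
  [modG : Module Q G]
  [freeF : Module.Free Q F]
  [freeG : Module.Free Q G]
  [finF : Module.Finite Q F]
  [finG : Module.Finite Q G]
  φ : F →ₗ[Q] G
  ψ : G →ₗ[Q] F
  φψ : ∀ y, φ (ψ y) = f • y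
  ψφ : ∀ x, ψ (φ x) = f • x

attribute [instance] MF.acF MF.acG MF.modF MF.modG MF.freeF MF.freeG MF.finF MF.finG

namespace MF

section basic

variable {Q : Type} [CommRing Q] {f : Q}

/-- Exchange the two maps of a matrix factorization. -/
def swap (μ : MF Q f) : MF Q f where
  F := μ.G
  G := μ.F
  φ := μ.ψ
  ψ := μ.φ
  φψ := μ.ψφ
  ψφ := μ.φψ

/-- Exactness of the periodic complex at one of the two spots. -/
def EF (μ : MF Q f) (Y : Type) [AddCommGroup Y] [Module Q Y] : Prop :=
  ∀ u : μ.F →ₗ[Q] Y, (∀ y, u (μ.ψ y) = 0) → ∃ v : μ.G →ₗ[Q] Y, ∀ x, v (μ.φ x) = u x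

/-- Exactness of the periodic complex at the other spot. -/
def EG (μ : MF Q f) (Y : Type) [AddCommGroup Y] [Module Q Y] : Prop :=
  ∀ v : μ.G →ₗ[Q] Y, (∀ x, v (μ.φ x) = 0) → ∃ u : μ.F →ₗ[Q] Y, ∀ y, u (μ.ψ y) = v y

/-- Exactness of the periodic complex. -/
def E (μ : MF Q f) (Y : Type) [AddCommGroup Y] [Module Q Y] : Prop := μ.EF Y ∧ μ.EG Y

lemma E.swap {μ : MF Q f} {Y : Type} [AddCommGroup Y] [Module Q Y] (h : μ.E Y) : μ.swap.E Y :=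
  ⟨h.2, h.1⟩

lemma lift {G P P' : Type} [AddCommGroup G] [AddCommGroup P] [AddCommGroup P'] [Module Q G]
    [Module Q P] [Module Q P'] [Module.Projective Q G] (g : G →ₗ[Q] P) (a : P' →ₗ[Q] P)
    (h : ∀ x, ∃ y, a y = g x) : ∃ w : G →ₗ[Q] P', ∀ x, a (w x) = g x := by
  obtain ⟨w, hw⟩ := Module.projective_lifting_property a.rangeRestrict
    (g.codRestrict (LinearMap.range a) h) a.surjective_rangeRestrict
  refine ⟨w, fun x => ?_⟩
  exact congrArg Subtype.val (LinearMap.congr_fun hw x)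

lemma EF_free (μ : MF Q f) {P Y : Type} [AddCommGroup Y] [Module Q Y] [AddCommGroup P] [Module Q P]
    (π : P →ₗ[Q] Y) (hπ : Function.Surjective π) (hker : ∀ p, π p = 0 → ∃ p', f • p' = p)
    (hf : IsSMulRegular P f) : μ.EF Y := by
  intro u hu
  obtain ⟨u', hu'⟩ := lift u π (fun x => hπ _)
  obtain ⟨w, hw⟩ := lift (u' ∘ₗ μ.ψ) (LinearMap.lsmul Q P f) (fun x => hker _ (by
    rw [LinearMap.comp_apply, hu', hu]))
  refine ⟨π ∘ₗ w, fun x => ?_⟩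
  have : w (μ.φ x) = u' x := by
    apply hf
    change f • w (μ.φ x) = f • u' x
    have := hw (μ.φ x)
    simp only [LinearMap.lsmul_apply, LinearMap.comp_apply, μ.ψφ, map_smul] at this
    exact this
  rw [LinearMap.comp_apply, this, hu']

lemma E_free (μ : MF Q f) {P Y : Type} [AddCommGroup Y] [Module Q Y] [AddCommGroup P] [Module Q P]
    (π : P →ₗ[Q] Y) (hπ : Function.Surjective π) (hker : ∀ p, π p = 0 → ∃ p', f • p' = p)
    (hf : IsSMulRegular P f) : μ.E Y :=
  ⟨μ.EF_free π hπ hker hf, μ.swap.EF_free π hπ hker hf⟩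

section ses

variable (μ : MF Q f) {Y₁ Y₂ Y₃ : Type} [AddCommGroup Y₁] [AddCommGroup Y₂] [AddCommGroup Y₃]
  [Module Q Y₁] [Module Q Y₂] [Module Q Y₃] (i : Y₁ →ₗ[Q] Y₂) (p : Y₂ →ₗ[Q] Y₃)

lemma EF_X₁ (hi : Function.Injective i) (hp : Function.Surjective p) (hip : Function.Exact i p)
    (hY : ∀ y : Y₂, f • y = 0) (h2 : μ.EF Y₂) (h3 : μ.EG Y₃) : μ.EF Y₁ := by
  intro u hu
  obtain ⟨v, hv⟩ := h2 (i ∘ₗ u) (fun y => by rw [LinearMap.comp_apply, hu, map_zero])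
  obtain ⟨w, hw⟩ := h3 (p ∘ₗ v) (fun x => by
    rw [LinearMap.comp_apply, hv]; exact hip.apply_apply_eq_zero _)
  obtain ⟨w', hw'⟩ := lift w p (fun x => hp _)
  obtain ⟨z, hz⟩ := lift (v - w' ∘ₗ μ.ψ) i (fun x => (hip _).1 (by
    rw [LinearMap.sub_apply, map_sub, LinearMap.comp_apply, hw', hw]
    exact sub_self _))
  refine ⟨z, fun x => hi ?_⟩
  rw [hz, LinearMap.sub_apply, hv, LinearMap.comp_apply, LinearMap.comp_apply, μ.ψφ, map_smul,
    hY, sub_zero]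

lemma EF_X₃ (hi : Function.Injective i) (hp : Function.Surjective p) (hip : Function.Exact i p)
    (hY : ∀ y : Y₂, f • y = 0) (h1 : μ.EG Y₁) (h2 : μ.EF Y₂) : μ.EF Y₃ := by
  intro u hu
  obtain ⟨u', hu'⟩ := lift u p (fun x => hp _)
  obtain ⟨w, hw⟩ := lift (u' ∘ₗ μ.ψ) i (fun y => (hip _).1 (by
    rw [LinearMap.comp_apply, hu', hu]))
  obtain ⟨t, ht⟩ := h1 w (fun x => hi (by
    rw [hw, LinearMap.comp_apply, μ.ψφ, map_smul, hY, map_zero]))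
  obtain ⟨v, hv⟩ := h2 (u' - i ∘ₗ t) (fun y => by
    have : t (μ.ψ y) = w y := ht y
    rw [LinearMap.sub_apply, LinearMap.comp_apply, this, hw, LinearMap.comp_apply, sub_self])
  refine ⟨p ∘ₗ v, fun x => ?_⟩
  rw [LinearMap.comp_apply, hv, LinearMap.sub_apply, map_sub, hu', LinearMap.comp_apply,
    hip.apply_apply_eq_zero, sub_zero]

lemma EF_X₂ (hi : Function.Injective i) (hp : Function.Surjective p) (hip : Function.Exact i p)
    (hY : ∀ y : Y₂, f • y = 0) (h1 : μ.EF Y₁) (h3 : μ.EF Y₃) : μ.EF Y₂ := by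
  intro u hu
  obtain ⟨v, hv⟩ := h3 (p ∘ₗ u) (fun y => by rw [LinearMap.comp_apply, hu, map_zero])
  obtain ⟨v', hv'⟩ := lift v p (fun x => hp _)
  obtain ⟨w, hw⟩ := lift (u - v' ∘ₗ μ.φ) i (fun y => (hip _).1 (by
    rw [LinearMap.sub_apply, LinearMap.comp_apply, map_sub, hv', hv, LinearMap.comp_apply,
      sub_self]))
  obtain ⟨t, ht⟩ := h1 w (fun x => hi (by
    rw [hw, LinearMap.sub_apply, LinearMap.comp_apply, μ.φψ, map_smul, hY, hu, map_zero,
      sub_zero]))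
  refine ⟨v' + i ∘ₗ t, fun x => ?_⟩
  rw [LinearMap.add_apply, LinearMap.comp_apply, ht, hw, LinearMap.sub_apply, LinearMap.comp_apply]
  abel

lemma E_X₁_iff_X₃ (hi : Function.Injective i) (hp : Function.Surjective p)
    (hip : Function.Exact i p) (hY : ∀ y : Y₂, f • y = 0) (h2 : μ.E Y₂) : μ.E Y₁ ↔ μ.E Y₃ :=
  ⟨fun h => ⟨μ.EF_X₃ i p hi hp hip hY h.2 h2.1, μ.swap.EF_X₃ i p hi hp hip hY h.1 h2.2⟩,
   fun h => ⟨μ.EF_X₁ i p hi hp hip hY h2.1 h.2, μ.swap.EF_X₁ i p hi hp hip hY h2.2 h.1⟩⟩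

lemma E_X₂_iff_X₃ (hi : Function.Injective i) (hp : Function.Surjective p)
    (hip : Function.Exact i p) (hY : ∀ y : Y₂, f • y = 0) (h1 : μ.E Y₁) : μ.E Y₂ ↔ μ.E Y₃ :=
  ⟨fun h => ⟨μ.EF_X₃ i p hi hp hip hY h1.2 h.1, μ.swap.EF_X₃ i p hi hp hip hY h1.1 h.2⟩,
   fun h => ⟨μ.EF_X₂ i p hi hp hip hY h1.1 h.1, μ.swap.EF_X₂ i p hi hp hip hY h1.2 h.2⟩⟩

end ses

lemma EF_congr (μ : MF Q f) {Y Y' : Type} [AddCommGroup Y] [AddCommGroup Y'] [Module Q Y]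
    [Module Q Y'] (e : Y ≃ₗ[Q] Y') (h : μ.EF Y) : μ.EF Y' := by
  intro u hu
  obtain ⟨v, hv⟩ := h (e.symm.toLinearMap ∘ₗ u) (fun y => by simp [hu])
  exact ⟨e.toLinearMap ∘ₗ v, fun x => by simp [hv]⟩

lemma E_congr (μ : MF Q f) {Y Y' : Type} [AddCommGroup Y] [AddCommGroup Y'] [Module Q Y]
    [Module Q Y'] (e : Y ≃ₗ[Q] Y') : μ.E Y ↔ μ.E Y' :=
  ⟨fun h => ⟨μ.EF_congr e h.1, μ.swap.EF_congr e h.2⟩,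
   fun h => ⟨μ.EF_congr e.symm h.1, μ.swap.EF_congr e.symm h.2⟩⟩

/-- The cokernel of the first map. -/
abbrev Cok (μ : MF Q f) : Type := μ.G ⧸ LinearMap.range μ.φ

lemma smul_Cok (μ : MF Q f) (y : μ.Cok) : f • y = 0 := by
  obtain ⟨y, rfl⟩ := Submodule.Quotient.mk_surjective _ y
  rw [← Submodule.Quotient.mk_smul, Submodule.Quotient.mk_eq_zero]
  exact ⟨μ.ψ y, μ.φψ y⟩

lemma regular_of_free {P : Type} [AddCommGroup P] [Module Q P] [Module.Free Q P]
    (hf : IsSMulRegular Q f) : IsSMulRegular P f := by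
  have := (TensorProduct.lid Q P).isSMulRegular_congr f
  exact this.1 (hf.rTensor P)

lemma φ_inj (μ : MF Q f) (hf : IsSMulRegular Q f) : Function.Injective μ.φ := by
  intro x y h
  apply regular_of_free (P := μ.F) hf
  change f • x = f • y
  rw [← μ.ψφ, ← μ.ψφ, h]

lemma finrank_eq [Nontrivial Q] (μ : MF Q f) (hf : IsSMulRegular Q f) :
    Module.finrank Q μ.F = Module.finrank Q μ.G :=
  le_antisymm (LinearMap.finrank_le_finrank_of_injective (μ.φ_inj hf))
    (LinearMap.finrank_le_finrank_of_injective (μ.swap.φ_inj hf))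

end basic

end MF

namespace MF

section reduction

variable {Q : Type} [CommRing Q] {f : Q}

/-- Two matrix factorizations that cannot be told apart by the exactness conditions. -/
structure Rel (μ ν : MF Q f) : Prop where
  ef : ∀ (Y : Type) [AddCommGroup Y] [Module Q Y], μ.EF Y ↔ ν.EF Y
  eg : ∀ (Y : Type) [AddCommGroup Y] [Module Q Y], μ.EG Y ↔ ν.EG Y
  c : ∀ κ : MF Q f, κ.E μ.Cok ↔ κ.E ν.Cok
  cs : ∀ κ : MF Q f, κ.E μ.swap.Cok ↔ κ.E ν.swap.Cok

lemma Rel.swap {μ ν : MF Q f} (h : Rel μ ν) : Rel μ.swap ν.swap :=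
  ⟨h.eg, h.ef, h.cs, h.c⟩

lemma Rel.refl (μ : MF Q f) : Rel μ μ :=
  ⟨fun _ _ _ => Iff.rfl, fun _ _ _ => Iff.rfl, fun _ => Iff.rfl, fun _ => Iff.rfl⟩

lemma Rel.trans {μ ν ρ : MF Q f} (h : Rel μ ν) (h' : Rel ν ρ) : Rel μ ρ :=
  ⟨fun Y _ _ => (h.ef Y).trans (h'.ef Y), fun Y _ _ => (h.eg Y).trans (h'.eg Y),
    fun κ => (h.c κ).trans (h'.c κ), fun κ => (h.cs κ).trans (h'.cs κ)⟩

/-- The projection of a module to the kernel of a functional `l` along `e`. -/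
def proj {P : Type} [AddCommGroup P] [Module Q P] (l : P →ₗ[Q] Q) (e : P) (h : l e = 1) :
    P →ₗ[Q] LinearMap.ker l :=
  LinearMap.codRestrict _ (LinearMap.id - l.smulRight e) (fun x => by simp [h])

lemma proj_coe {P : Type} [AddCommGroup P] [Module Q P] (l : P →ₗ[Q] Q) (e : P) (h : l e = 1)
    (x : P) : (proj l e h x : P) = x - l x • e := rfl

lemma proj_ker {P : Type} [AddCommGroup P] [Module Q P] (l : P →ₗ[Q] Q) (e : P) (h : l e = 1)
    (x : LinearMap.ker l) : proj l e h x = x := by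
  apply Subtype.ext
  rw [proj_coe, LinearMap.mem_ker.1 x.2, zero_smul, sub_zero]

lemma ker_projective {P : Type} [AddCommGroup P] [Module Q P] (l : P →ₗ[Q] Q) (e : P)
    (h : l e = 1) [Module.Projective Q P] : Module.Projective Q (LinearMap.ker l) :=
  Module.Projective.of_split (LinearMap.ker l).subtype (proj l e h)
    (LinearMap.ext fun x => proj_ker l e h x)

lemma ker_finite {P : Type} [AddCommGroup P] [Module Q P] (l : P →ₗ[Q] Q) (e : P)
    (h : l e = 1) [Module.Finite Q P] : Module.Finite Q (LinearMap.ker l) :=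
  Module.Finite.of_surjective (proj l e h) (fun x => ⟨x, proj_ker l e h x⟩)

variable [IsLocalRing Q]

lemma ker_finrank {P : Type} [AddCommGroup P] [Module Q P] (l : P →ₗ[Q] Q) (e : P)
    (h : l e = 1) [Module.Free Q P] [Module.Finite Q P] :
    Module.finrank Q (LinearMap.ker l) < Module.finrank Q P := by
  haveI := ker_finite l e h
  haveI := ker_projective l e h
  haveI : Module.Free Q (LinearMap.ker l) := Module.free_of_flat_of_isLocalRing
  let m : (LinearMap.ker l × Q) →ₗ[Q] P :=
    (LinearMap.ker l).subtype.coprod (LinearMap.toSpanSingleton Q P e)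
  have hm : Function.Injective m := by
    rw [← LinearMap.ker_eq_bot, LinearMap.ker_eq_bot']
    rintro ⟨x, a⟩ hx
    have hx' : (x : P) + a • e = 0 := by simpa [m] using hx
    have ha : a = 0 := by
      have := congrArg l hx'
      rw [map_add, LinearMap.mem_ker.1 x.2, map_smul, h] at this
      simpa using this
    subst ha
    have : (x : P) = 0 := by simpa using hx'
    ext
    · exact this
    · rfl
  have := LinearMap.finrank_le_finrank_of_injective hm
  rw [Module.finrank_prod, Module.finrank_self] at this
  omega

lemma reduce_step (hf : IsSMulRegular Q f) (μ : MF Q f) (e : μ.F) (l : μ.G →ₗ[Q] Q)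
    (h : l (μ.φ e) = 1) :
    ∃ ν : MF Q f, Module.finrank Q ν.F + Module.finrank Q ν.G <
      Module.finrank Q μ.F + Module.finrank Q μ.G ∧ Rel μ ν := by
  have hG : ∀ y ∈ LinearMap.ker l, μ.ψ y ∈ LinearMap.ker (l ∘ₗ μ.φ) := fun y hy => by
    rw [LinearMap.mem_ker] at hy ⊢
    rw [LinearMap.comp_apply, μ.φψ, map_smul, hy, smul_zero]
  have h' : (l ∘ₗ μ.φ) e = 1 := h
  haveI := ker_finite (l ∘ₗ μ.φ) e h'
  haveI := ker_projective (l ∘ₗ μ.φ) e h'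
  haveI : Module.Free Q (LinearMap.ker (l ∘ₗ μ.φ)) := Module.free_of_flat_of_isLocalRing
  haveI := ker_finite l _ h
  haveI := ker_projective l _ h
  haveI : Module.Free Q (LinearMap.ker l) := Module.free_of_flat_of_isLocalRing
  let φ' : LinearMap.ker (l ∘ₗ μ.φ) →ₗ[Q] LinearMap.ker l := μ.φ.restrict (fun x hx => hx)
  let ψ' : LinearMap.ker l →ₗ[Q] LinearMap.ker (l ∘ₗ μ.φ) := μ.ψ.restrict hG
  let ν : MF Q f :=
    { F := LinearMap.ker (l ∘ₗ μ.φ)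
      G := LinearMap.ker l
      φ := φ'
      ψ := ψ'
      φψ := fun y => Subtype.ext (μ.φψ y)
      ψφ := fun y => Subtype.ext (μ.ψφ y) }
  let qF := proj (l ∘ₗ μ.φ) e h'
  let qG := proj l (μ.φ e) h
  have hqF : ∀ x, (qF x : μ.F) = x - l (μ.φ x) • e := fun x => rfl
  have hqG : ∀ x, (qG x : μ.G) = x - l x • μ.φ e := fun x => rfl
  have hqF' : ∀ x : LinearMap.ker (l ∘ₗ μ.φ), qF x = x := fun x => proj_ker _ _ _ x
  have hqG' : ∀ x : LinearMap.ker l, qG x = x := fun x => proj_ker _ _ _ x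
  have hφ : ∀ x, qG (μ.φ x) = φ' (qF x) := fun x => Subtype.ext (by
    rw [hqG]
    change _ = μ.φ (qF x)
    rw [hqF, map_sub, map_smul])
  have hψ : ∀ x, qF (μ.ψ x) = ψ' (qG x) := fun x => Subtype.ext (by
    rw [hqF]
    change _ = μ.ψ (qG x)
    rw [hqG, map_sub, map_smul, μ.φψ, map_smul, μ.ψφ, smul_comm, smul_assoc, smul_comm])
  have hφc : ∀ x, (φ' x : μ.G) = μ.φ x := fun x => rfl
  have hψc : ∀ x, (ψ' x : μ.F) = μ.ψ x := fun x => rfl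
  refine ⟨ν, add_lt_add (ker_finrank _ e h') (ker_finrank _ _ h), ⟨?_, ?_, ?_, ?_⟩⟩
  · intro Y _ _
    constructor
    · intro H u hu
      obtain ⟨v, hv⟩ := H (u ∘ₗ qF) (fun y => by
        rw [LinearMap.comp_apply, hψ]; exact hu _)
      refine ⟨v ∘ₗ (LinearMap.ker l).subtype, fun x => ?_⟩
      change v (μ.φ (x : LinearMap.ker (l ∘ₗ μ.φ))) = u x
      rw [hv, LinearMap.comp_apply, hqF']
    · intro H u hu
      obtain ⟨v, hv⟩ := H (u ∘ₗ (LinearMap.ker (l ∘ₗ μ.φ)).subtype) (fun y => hu _)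
      refine ⟨(v : LinearMap.ker l →ₗ[Q] Y) ∘ₗ qG + l.smulRight (u e), fun x => ?_⟩
      have := hv (qF x)
      change v (φ' (qF x)) = u (qF x) at this
      rw [← hφ, hqF] at this
      rw [LinearMap.add_apply, LinearMap.comp_apply, this, LinearMap.smulRight_apply, map_sub,
        map_smul, sub_add_cancel]
  · intro Y _ _
    constructor
    · intro H v hv
      obtain ⟨u, hu⟩ := H (v ∘ₗ qG) (fun y => by
        rw [LinearMap.comp_apply, hφ]; exact hv _)
      refine ⟨u ∘ₗ (LinearMap.ker (l ∘ₗ μ.φ)).subtype, fun x => ?_⟩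
      change u (μ.ψ (x : LinearMap.ker l)) = v x
      rw [hu, LinearMap.comp_apply, hqG']
    · intro H v hv
      obtain ⟨u, hu⟩ := H (v ∘ₗ (LinearMap.ker l).subtype) (fun y => hv _)
      refine ⟨(u : LinearMap.ker (l ∘ₗ μ.φ) →ₗ[Q] Y) ∘ₗ qF, fun x => ?_⟩
      have := hu (qG x)
      change u (ψ' (qG x)) = v (qG x) at this
      rw [LinearMap.comp_apply, hψ, this, hqG, map_sub, map_smul, hv, smul_zero, sub_zero]
  · intro κ
    let m : μ.G →ₗ[Q] LinearMap.ker l ⧸ LinearMap.range φ' := (LinearMap.range φ').mkQ ∘ₗ qG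
    have hm : Function.Surjective m :=
      (Submodule.mkQ_surjective _).comp (fun x => ⟨x, hqG' x⟩)
    have hk : LinearMap.range μ.φ = LinearMap.ker m := by
      ext y
      rw [LinearMap.mem_ker, LinearMap.comp_apply, Submodule.mkQ_apply,
        Submodule.Quotient.mk_eq_zero]
      constructor
      · rintro ⟨x, rfl⟩
        exact ⟨qF x, (hφ x).symm⟩
      · rintro ⟨x, hx⟩
        have := congrArg Subtype.val hx
        rw [hφc, hqG] at this
        refine ⟨x + l y • e, ?_⟩
        rw [map_add, this, map_smul, sub_add_cancel]
    exact κ.E_congr ((Submodule.quotEquivOfEq _ _ hk).trans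
      (LinearMap.quotKerEquivOfSurjective m hm))
  · intro κ
    let p : (μ.F ⧸ LinearMap.range μ.ψ) →ₗ[Q] LinearMap.ker (l ∘ₗ μ.φ) ⧸ LinearMap.range ψ' :=
      Submodule.mapQ _ _ qF (by
        rintro _ ⟨y, rfl⟩
        exact ⟨qG y, (hψ y).symm⟩)
    have hpm : ∀ x : μ.F, p (Submodule.Quotient.mk x) = Submodule.Quotient.mk (qF x) :=
      fun x => rfl
    have hp : Function.Surjective p := by
      intro z
      obtain ⟨z, rfl⟩ := Submodule.Quotient.mk_surjective _ z
      exact ⟨Submodule.Quotient.mk z, by rw [hpm, hqF']⟩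
    have hpe : p (Submodule.Quotient.mk e) = 0 := by
      have : qF e = 0 := Subtype.ext (by rw [hqF, h, one_smul, sub_self]; rfl)
      rw [hpm, this, Submodule.Quotient.mk_zero]
    refine κ.E_X₂_iff_X₃ (LinearMap.ker p).subtype p Subtype.val_injective hp
      (LinearMap.exact_subtype_ker_map p) μ.swap.smul_Cok ?_
    refine κ.E_free (LinearMap.toSpanSingleton Q (LinearMap.ker p)
      ⟨Submodule.Quotient.mk e, hpe⟩) ?_ ?_ hf
    · rintro ⟨x, hx⟩
      obtain ⟨x, rfl⟩ := Submodule.Quotient.mk_surjective _ x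
      rw [LinearMap.mem_ker, hpm, Submodule.Quotient.mk_eq_zero] at hx
      obtain ⟨y, hy⟩ := hx
      have := congrArg Subtype.val hy
      rw [hψc, hqF] at this
      refine ⟨l (μ.φ x), Subtype.ext ?_⟩
      change l (μ.φ x) • Submodule.Quotient.mk e = Submodule.Quotient.mk x
      rw [← Submodule.Quotient.mk_smul, eq_comm, Submodule.Quotient.eq, ← this]
      exact ⟨_, rfl⟩
    · intro a ha
      have := congrArg Subtype.val ha
      change a • (Submodule.Quotient.mk e : μ.F ⧸ LinearMap.range μ.ψ) = 0 at this
      rw [← Submodule.Quotient.mk_smul, Submodule.Quotient.mk_eq_zero] at this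
      obtain ⟨y, hy⟩ := this
      refine ⟨l y, ?_⟩
      have := congrArg (fun t => l (μ.φ t)) hy
      simp only [μ.φψ, map_smul, h] at this
      rw [this, smul_eq_mul, mul_one]

/-- Reduced matrix factorizations. -/
def Red (μ : MF Q f) : Prop :=
  (∀ x, μ.φ x ∈ maximalIdeal Q • (⊤ : Submodule Q μ.G)) ∧
    (∀ y, μ.ψ y ∈ maximalIdeal Q • (⊤ : Submodule Q μ.F))

lemma exists_functional {P : Type} [AddCommGroup P] [Module Q P] [Module.Free Q P]
    (x : P) (hx : x ∉ maximalIdeal Q • (⊤ : Submodule Q P)) : ∃ l : P →ₗ[Q] Q, l x = 1 := by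
  let b := Module.Free.chooseBasis Q P
  by_contra hcon
  push Not at hcon
  apply hx
  rw [← b.linearCombination_repr x, Finsupp.linearCombination_apply, Finsupp.sum]
  refine Submodule.sum_mem _ fun i _ => Submodule.smul_mem_smul ?_ trivial
  by_contra hu
  rw [mem_maximalIdeal, mem_nonunits_iff, not_not] at hu
  obtain ⟨c, hc⟩ := hu.exists_left_inv
  refine hcon (c • b.coord i) ?_
  rw [LinearMap.smul_apply, Module.Basis.coord_apply, smul_eq_mul, hc]

lemma exists_red (hf : IsSMulRegular Q f) (n : ℕ) : ∀ (μ : MF Q f)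
    (_ : Module.finrank Q μ.F + Module.finrank Q μ.G ≤ n), ∃ ν : MF Q f, ν.Red ∧ Rel μ ν := by
  induction n with
  | zero =>
    intro μ h
    by_cases hr : μ.Red
    · exact ⟨μ, hr, Rel.refl μ⟩
    · exfalso
      apply hr
      have h1 : Module.finrank Q μ.F = 0 := by omega
      have h2 : Module.finrank Q μ.G = 0 := by omega
      rw [Module.finrank_eq_zero_iff_of_free] at h1 h2
      refine ⟨fun x => ?_, fun y => ?_⟩
      · rw [Subsingleton.elim (μ.φ x) 0]; exact zero_mem _
      · rw [Subsingleton.elim (μ.ψ y) 0]; exact zero_mem _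
  | succ n ih =>
    intro μ h
    by_cases hr : μ.Red
    · exact ⟨μ, hr, Rel.refl μ⟩
    · rw [Red, not_and_or] at hr
      push Not at hr
      rcases hr with ⟨x, hx⟩ | ⟨x, hx⟩
      · obtain ⟨l, hl⟩ := exists_functional _ hx
        obtain ⟨ν, hν, hr⟩ := μ.reduce_step hf x l hl
        obtain ⟨ρ, h1, h2⟩ := ih ν (by omega)
        exact ⟨ρ, h1, hr.trans h2⟩
      · obtain ⟨l, hl⟩ := exists_functional _ hx
        obtain ⟨ν, hν, hr⟩ := μ.swap.reduce_step hf x l hl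
        change _ < Module.finrank Q μ.G + Module.finrank Q μ.F at hν
        obtain ⟨ρ, h1, h2⟩ := ih ν (by omega)
        exact ⟨ρ.swap, ⟨h1.2, h1.1⟩, (hr.trans h2).swap⟩

end reduction

end MF

namespace MF

section key

variable {Q : Type} [CommRing Q] {f : Q}

lemma hom_mem_smul (J : Ideal Q) {P P' : Type} [AddCommGroup P] [AddCommGroup P'] [Module Q P]
    [Module Q P'] [Module.Free Q P] [Module.Finite Q P] (u : P →ₗ[Q] P')
    (hu : ∀ x, u x ∈ J • (⊤ : Submodule Q P')) : u ∈ J • (⊤ : Submodule Q (P →ₗ[Q] P')) := by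
  let b := Module.Free.chooseBasis Q P
  have h : u = ∑ i, LinearMap.smulRightₗ (b.coord i) (u (b i)) := by
    refine b.ext fun j => ?_
    rw [LinearMap.sum_apply]
    simp [Finsupp.single_apply]
  rw [h]
  refine Submodule.sum_mem _ fun i _ => ?_
  have : LinearMap.smulRightₗ (b.coord i) (u (b i)) ∈ Submodule.map
      (LinearMap.smulRightₗ (b.coord i) : P' →ₗ[Q] (P →ₗ[Q] P')) (J • ⊤) :=
    Submodule.mem_map_of_mem (hu _)
  rw [Submodule.map_smul''] at this
  exact Submodule.smul_mono le_rfl le_top this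

lemma map_mem_smul (J : Ideal Q) {P P' : Type} [AddCommGroup P] [AddCommGroup P'] [Module Q P]
    [Module Q P'] (t : P →ₗ[Q] P') {x : P} (hx : x ∈ J • (⊤ : Submodule Q P)) :
    t x ∈ J • (⊤ : Submodule Q P') := by
  have : t x ∈ Submodule.map t (J • ⊤) := Submodule.mem_map_of_mem hx
  rw [Submodule.map_smul''] at this
  exact Submodule.smul_mono le_rfl le_top this

lemma PD_descend {B C H H' : Type} [AddCommGroup B] [AddCommGroup C] [AddCommGroup H]
    [AddCommGroup H'] [Module Q B] [Module Q C] [Module Q H] [Module Q H']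
    (i : B →ₗ[Q] H) (p : H →ₗ[Q] C) (hi : Function.Injective i) (hp : Function.Surjective p)
    (hip : Function.Exact i p)
    (i' : C →ₗ[Q] H') (p' : H' →ₗ[Q] B) (hi' : Function.Injective i')
    (hp' : Function.Surjective p') (hip' : Function.Exact i' p')
    (hH : PD Q H 2) (hH' : PD Q H' 2) (n : ℕ) (hB : PD Q B (n + 2)) (hC : PD Q C (n + 2)) :
    PD Q B 2 := by
  induction n with
  | zero => exact hB
  | succ n ih =>
    exact ih (PD.X₁ i p hi hp hip (hH.mono (by omega)) hC)
      (PD.X₁ i' p' hi' hp' hip' (hH'.mono (by omega)) hB)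

lemma exact_range {H H' : Type} [AddCommGroup H]
    [AddCommGroup H'] [Module Q H] [Module Q H'] (a : H →ₗ[Q] H') (b : H' →ₗ[Q] H)
    (h : Function.Exact b a) :
    Function.Exact (LinearMap.range b).subtype a.rangeRestrict := by
  intro y
  constructor
  · intro hy
    have : a y = 0 := congrArg Subtype.val hy
    exact ⟨⟨y, (h y).1 this⟩, rfl⟩
  · rintro ⟨⟨y, hy⟩, rfl⟩
    exact Subtype.ext ((h y).2 hy)

lemma PD_periodic {H H' : Type} [AddCommGroup H]
    [AddCommGroup H'] [Module Q H] [Module Q H'] [Module.Finite Q H] [Module.Finite Q H']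
    (a : H →ₗ[Q] H') (b : H' →ₗ[Q] H) (h : Function.Exact a b) (h' : Function.Exact b a)
    (hH : PD Q H 2) (hH' : PD Q H' 2) (N : ℕ)
    (hN : ∀ (M : Type) [AddCommGroup M] [Module Q M] [Module.Finite Q M], PD Q M N) :
    PD Q (LinearMap.range b) 2 :=
  PD_descend (B := LinearMap.range b) (C := LinearMap.range a) (H := H) (H' := H')
    (LinearMap.range b).subtype a.rangeRestrict (Submodule.injective_subtype _)
    a.surjective_rangeRestrict (exact_range a b h') (LinearMap.range a).subtype b.rangeRestrict
    (Submodule.injective_subtype _) b.surjective_rangeRestrict (exact_range b a h) hH hH' N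
    ((hN _).mono (by omega)) ((hN _).mono (by omega))

lemma PD_hom {L : Type} [AddCommGroup L] [Module Q L] [Module.Free Q L] [Module.Finite Q L]
    (μ : MF Q f) (hf : IsSMulRegular Q f) : PD Q (L →ₗ[Q] μ.Cok) 2 := by
  refine PD.X₃ (n := 1) (LinearMap.compRight Q (M := L) μ.φ)
    (LinearMap.compRight Q (M := L) (LinearMap.range μ.φ).mkQ) ?_ ?_ ?_
    (PD_one_iff.2 inferInstance) ((PD_one_iff.2 inferInstance).mono one_le_two)
  · intro u v h
    ext x
    exact μ.φ_inj hf (LinearMap.congr_fun h x)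
  · intro u
    obtain ⟨w, hw⟩ := lift u (LinearMap.range μ.φ).mkQ (fun x => Submodule.mkQ_surjective _ _)
    exact ⟨w, LinearMap.ext hw⟩
  · intro u
    constructor
    · intro h
      obtain ⟨w, hw⟩ := lift u μ.φ (fun x => by
        have := LinearMap.congr_fun h x
        exact (Submodule.Quotient.mk_eq_zero _).1 this)
      exact ⟨w, LinearMap.ext hw⟩
    · rintro ⟨w, rfl⟩
      ext x
      exact (Submodule.Quotient.mk_eq_zero _).2 ⟨_, rfl⟩

variable [IsLocalRing Q]

lemma inj_of_ker_le {D H : Type} [AddCommGroup D] [AddCommGroup H] [Module Q D] [Module Q H]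
    [Module.Finite Q D] (T : D →ₗ[Q] H) [Module.Projective Q (LinearMap.range T)]
    (h : LinearMap.ker T ≤ maximalIdeal Q • ⊤) : Function.Injective T := by
  obtain ⟨s, hs⟩ := Module.projective_lifting_property T.rangeRestrict LinearMap.id
    T.surjective_rangeRestrict
  have hs' : ∀ x, T (s x) = x := fun x => congrArg Subtype.val (LinearMap.congr_fun hs x)
  let r : D →ₗ[Q] D := LinearMap.id - s ∘ₗ T.rangeRestrict
  have hr : ∀ x, r x = x - s (T.rangeRestrict x) := fun x => rfl
  have hrange : LinearMap.range r = LinearMap.ker T := by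
    apply le_antisymm
    · rintro _ ⟨x, rfl⟩
      rw [LinearMap.mem_ker, hr, map_sub, hs']
      exact sub_self _
    · intro x hx
      refine ⟨x, ?_⟩
      have : T.rangeRestrict x = 0 := Subtype.ext hx
      rw [hr, this, map_zero, sub_zero]
  rw [← LinearMap.ker_eq_bot]
  refine Submodule.eq_bot_of_le_smul_of_le_jacobson_bot (maximalIdeal Q) _ ?_ ?_
    (IsLocalRing.maximalIdeal_le_jacobson _)
  · rw [← hrange, LinearMap.range_eq_map]
    exact (Module.Finite.fg_top).map r
  · intro x hx
    have h1 : r x = x := by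
      have : T.rangeRestrict x = 0 := Subtype.ext hx
      rw [hr, this, map_zero, sub_zero]
    have h2 : r x ∈ Submodule.map r (maximalIdeal Q • ⊤) := Submodule.mem_map_of_mem (h hx)
    rwa [Submodule.map_smul'', ← LinearMap.range_eq_map, hrange, h1] at h2

section pieces

variable (κ μ : MF Q f) {P : Type} [AddCommGroup P] [Module Q P] (π : μ.G →ₗ[Q] P)

/-- The combined map of the total complex. -/
def T : ((κ.G →ₗ[Q] μ.G) × (κ.F →ₗ[Q] μ.F)) →ₗ[Q] (κ.F →ₗ[Q] μ.G) :=
  (LinearMap.lcomp Q _ κ.φ).coprod (LinearMap.compRight Q μ.φ)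

lemma T_apply (u : κ.G →ₗ[Q] μ.G) (v : κ.F →ₗ[Q] μ.F) (x : κ.F) :
    T κ μ (u, v) x = u (κ.φ x) + μ.φ (v x) := rfl

/-- Precomposition with the second map. -/
def ψs (P : Type) [AddCommGroup P] [Module Q P] : (κ.F →ₗ[Q] P) →ₗ[Q] (κ.G →ₗ[Q] P) :=
  LinearMap.lcomp Q _ κ.ψ

lemma key_B [Module.Finite Q P] (hP : ∀ y : P, f • y = 0) (hG : PD Q (κ.G →ₗ[Q] P) 2)
    (hF : PD Q (κ.F →ₗ[Q] P) 2) (N : ℕ)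
    (hN : ∀ (M : Type) [AddCommGroup M] [Module Q M] [Module.Finite Q M], PD Q M N)
    (h : κ.E P) : PD Q (LinearMap.range (ψs κ P)) 2 := by
  let φs : (κ.G →ₗ[Q] P) →ₗ[Q] (κ.F →ₗ[Q] P) := LinearMap.lcomp Q _ κ.φ
  refine PD_periodic φs (ψs κ P) ?_ ?_ hG hF N hN
  · intro u
    constructor
    · intro hu
      obtain ⟨v, hv⟩ := h.1 u (fun x => LinearMap.congr_fun hu x)
      exact ⟨v, LinearMap.ext hv⟩
    · rintro ⟨v, rfl⟩
      ext x
      change v (κ.φ (κ.ψ x)) = 0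
      rw [κ.φψ, map_smul, hP]
  · intro u
    constructor
    · intro hu
      obtain ⟨v, hv⟩ := h.2 u (fun x => LinearMap.congr_fun hu x)
      exact ⟨v, LinearMap.ext hv⟩
    · rintro ⟨v, rfl⟩
      ext x
      change v (κ.ψ (κ.φ x)) = 0
      rw [κ.ψφ, map_smul, hP]

/-- The map whose kernel is the image of `T`. -/
def S : (κ.F →ₗ[Q] μ.G) →ₗ[Q] LinearMap.range (ψs κ P) :=
  (ψs κ P).rangeRestrict ∘ₗ LinearMap.compRight Q π

lemma S_iff (w : κ.F →ₗ[Q] μ.G) : S κ μ π w = 0 ↔ ∀ y, π (w (κ.ψ y)) = 0 := by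
  constructor
  · intro hw y
    exact LinearMap.congr_fun (congrArg Subtype.val hw : ψs κ P (π ∘ₗ w) = 0) y
  · intro hw
    apply Subtype.ext
    exact LinearMap.ext hw

lemma key_K (hπs : Function.Surjective π) (hB : PD Q (LinearMap.range (ψs κ P)) 2) :
    Module.Projective Q (LinearMap.ker (S κ μ π)) := by
  have hSs : Function.Surjective (S κ μ π) := by
    refine (ψs κ P).surjective_rangeRestrict.comp ?_
    intro u
    obtain ⟨w, hw⟩ := lift u π (fun x => hπs _)
    exact ⟨w, LinearMap.ext hw⟩
  exact PD_one_iff.1 (PD.X₁ (LinearMap.ker (S κ μ π)).subtype (S κ μ π)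
    (Submodule.injective_subtype _) hSs
      (LinearMap.exact_subtype_ker_map _) (PD_one_iff.2 inferInstance) hB)

lemma key_T (hπs : Function.Surjective π) (hπ : ∀ y, π y = 0 ↔ ∃ x, μ.φ x = y)
    (hP : ∀ y : P, f • y = 0) (h : κ.E P) :
    LinearMap.range (T κ μ) = LinearMap.ker (S κ μ π) := by
  apply le_antisymm
  · rintro _ ⟨⟨u, v⟩, rfl⟩
    rw [LinearMap.mem_ker, S_iff]
    intro y
    rw [T_apply, κ.φψ, map_smul, map_add, map_smul, hP, zero_add]
    exact (hπ _).2 ⟨_, rfl⟩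
  · intro w hw
    rw [LinearMap.mem_ker, S_iff] at hw
    obtain ⟨v₀, hv₀⟩ := h.1 (π ∘ₗ w) hw
    obtain ⟨u, hu⟩ := lift v₀ π (fun x => hπs _)
    obtain ⟨v, hv⟩ := lift (w - u ∘ₗ κ.φ) μ.φ (fun x => (hπ _).1 (by
      rw [LinearMap.sub_apply, LinearMap.comp_apply, map_sub, hu, hv₀, LinearMap.comp_apply,
        sub_self]))
    refine ⟨(u, v), LinearMap.ext fun x => ?_⟩
    rw [T_apply, hv, LinearMap.sub_apply, LinearMap.comp_apply]
    abel

lemma key_inj (hκ : κ.Red) (hμ : μ.Red) (hf : IsSMulRegular Q f)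
    (hπs : Function.Surjective π) (hπ : ∀ y, π y = 0 ↔ ∃ x, μ.φ x = y) (h : κ.E P)
    [Module.Projective Q (LinearMap.range (T κ μ))] : Function.Injective (T κ μ) := by
  apply inj_of_ker_le
  rintro ⟨u, v⟩ huv
  have huv' : ∀ x, u (κ.φ x) + μ.φ (v x) = 0 := fun x => LinearMap.congr_fun huv x
  obtain ⟨t, ht⟩ := h.2 (π ∘ₗ u) (fun x => by
    rw [LinearMap.comp_apply, eq_neg_of_add_eq_zero_left (huv' x), ← map_neg]
    exact (hπ _).2 ⟨_, rfl⟩)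
  obtain ⟨w, hw⟩ := lift t π (fun x => hπs _)
  obtain ⟨z, hz⟩ := lift (u - w ∘ₗ κ.ψ) μ.φ (fun x => (hπ _).1 (by
    rw [LinearMap.sub_apply, LinearMap.comp_apply, map_sub, hw, ht, LinearMap.comp_apply,
      sub_self]))
  have hu : ∀ y, u y = w (κ.ψ y) + μ.φ (z y) := fun y => by
    rw [hz, LinearMap.sub_apply, LinearMap.comp_apply]
    abel
  have hv : ∀ x, v x = -(μ.ψ (w x) + z (κ.φ x)) := fun x => by
    apply μ.φ_inj hf
    rw [eq_neg_of_add_eq_zero_right (huv' x), hu, κ.ψφ, map_neg, map_add, μ.φψ, map_smul]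
  have e1 : u ∈ maximalIdeal Q • (⊤ : Submodule Q (κ.G →ₗ[Q] μ.G)) :=
    hom_mem_smul _ _ fun y => by
      rw [hu]
      exact add_mem (map_mem_smul _ w (hκ.2 y)) (hμ.1 _)
  have e2 : v ∈ maximalIdeal Q • (⊤ : Submodule Q (κ.F →ₗ[Q] μ.F)) :=
    hom_mem_smul _ _ fun y => by
      rw [hv]
      exact neg_mem (add_mem (hμ.2 _) (map_mem_smul _ z (hκ.1 y)))
  have e3 := add_mem (map_mem_smul _ (LinearMap.inl Q _ (κ.F →ₗ[Q] μ.F)) e1)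
    (map_mem_smul _ (LinearMap.inr Q (κ.G →ₗ[Q] μ.G) _) e2)
  simpa using e3

end pieces

theorem key (κ μ : MF Q f) (hκ : κ.Red) (hμ : μ.Red) (hf : IsSMulRegular Q f) (N : ℕ)
    (hN : ∀ (M : Type) [AddCommGroup M] [Module Q M] [Module.Finite Q M], PD Q M N)
    (h : κ.E μ.Cok) : Module.finrank Q κ.F = 0 ∨ Module.finrank Q μ.F = 0 := by
  have hπ : ∀ y, (LinearMap.range μ.φ).mkQ y = 0 ↔ ∃ x, μ.φ x = y :=
    fun y => Submodule.Quotient.mk_eq_zero _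
  have hπs : Function.Surjective (LinearMap.range μ.φ).mkQ := Submodule.mkQ_surjective _
  have hB := key_B κ μ.smul_Cok (PD_hom μ hf) (PD_hom μ hf) N hN h
  have hK := key_K κ μ _ hπs hB
  have hT := key_T κ μ _ hπs hπ μ.smul_Cok h
  haveI : Module.Projective Q (LinearMap.range (T κ μ)) := hT ▸ hK
  have hinj := key_inj κ μ _ hκ hμ hf hπs hπ h
  have hr := LinearMap.finrank_le_finrank_of_injective hinj
  rw [Module.finrank_prod, Module.finrank_linearMap, Module.finrank_linearMap,
    Module.finrank_linearMap, ← κ.finrank_eq hf, ← μ.finrank_eq hf] at hr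
  exact mul_eq_zero.1 (by omega)

end key

end MF

namespace MF

section ext

variable {Q : Type} [CommRing Q] {f : Q}

lemma descend {G L Y : Type} [AddCommGroup G] [AddCommGroup L] [AddCommGroup Y] [Module Q G]
    [Module Q L] [Module Q Y] (q : G →ₗ[Q] L) (hq : Function.Surjective q) (g : G →ₗ[Q] Y)
    (h : ∀ y, q y = 0 → g y = 0) : ∃ g' : L →ₗ[Q] Y, ∀ y, g' (q y) = g y := by
  refine ⟨(LinearMap.ker q).liftQ g h ∘ₗ (q.quotKerEquivOfSurjective hq).symm.toLinearMap,
    fun y => ?_⟩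
  have : (q.quotKerEquivOfSurjective hq).symm (q y) = Submodule.Quotient.mk y := by
    rw [LinearEquiv.symm_apply_eq]
    rfl
  rw [LinearMap.comp_apply, LinearEquiv.coe_coe, this]
  rfl

lemma smul_eq_zero_of_tower {Y : Type} [AddCommGroup Y] [Module Q Y]
    [Module (Q ⧸ Ideal.span {f}) Y] [IsScalarTower Q (Q ⧸ Ideal.span {f}) Y] (y : Y) :
    f • y = 0 := by
  rw [← algebraMap_smul (Q ⧸ Ideal.span {f}) f y]
  have : algebraMap Q (Q ⧸ Ideal.span {f}) f = 0 :=
    Ideal.Quotient.eq_zero_iff_mem.2 (Ideal.mem_span_singleton_self f)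
  rw [this, zero_smul]

lemma exists_cover (f : Q) (G : Type) [AddCommGroup G] [Module Q G] [Module.Free Q G]
    [Module.Finite Q G] : ∃ (ι : Type) (_ : Fintype ι)
      (q : G →ₗ[Q] (ι → Q ⧸ Ideal.span {f})),
      Function.Surjective q ∧ ∀ y, q y = 0 → ∃ y', f • y' = y := by
  let b := Module.Free.chooseBasis Q G
  refine ⟨_, inferInstance, (LinearMap.pi fun i => (Submodule.mkQ (Ideal.span {f})) ∘ₗ
    LinearMap.proj i) ∘ₗ b.equivFun.toLinearMap, ?_, ?_⟩
  · intro z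
    choose w hw using fun i => Submodule.mkQ_surjective (Ideal.span {f}) (z i)
    refine ⟨b.equivFun.symm w, ?_⟩
    funext i
    simp only [LinearMap.comp_apply, LinearEquiv.coe_coe, LinearEquiv.apply_symm_apply,
      LinearMap.pi_apply, LinearMap.proj_apply]
    exact hw i
  · intro y hy
    have : ∀ i, ∃ a, f * a = b.equivFun y i := fun i => by
      have h1 : (Submodule.Quotient.mk (b.equivFun y i) : Q ⧸ Ideal.span {f}) = 0 := congrFun hy i
      rw [Submodule.Quotient.mk_eq_zero, Ideal.mem_span_singleton'] at h1
      obtain ⟨a, ha⟩ := h1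
      exact ⟨a, by rw [mul_comm, ha]⟩
    choose a ha using this
    refine ⟨b.equivFun.symm a, ?_⟩
    apply b.equivFun.injective
    rw [map_smul, LinearEquiv.apply_symm_apply]
    funext i
    exact ha i

/-- The cokernel of a matrix factorization of `f` is a module over `Q/(f)`. -/
noncomputable instance cokMod (μ : MF Q f) : Module (Q ⧸ Ideal.span {f}) μ.Cok :=
  Module.IsTorsionBySet.module (I := Ideal.span {f})
    ((Module.isTorsionBySet_span_singleton_iff f).2 μ.smul_Cok)

instance cokTower (μ : MF Q f) : IsScalarTower Q (Q ⧸ Ideal.span {f}) μ.Cok :=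
  Module.IsTorsionBySet.isScalarTower (I := Ideal.span {f})
    ((Module.isTorsionBySet_span_singleton_iff f).2 μ.smul_Cok)

/-- Exactness of the periodic complex at a given spot. -/
def EN (Y : Type) [AddCommGroup Y] [Module Q Y] : ℕ → MF Q f → Prop
  | 0, μ => μ.EF Y
  | n + 1, μ => EN Y n μ.swap

lemma EN_even (Y : Type) [AddCommGroup Y] [Module Q Y] (n : ℕ) (μ : MF Q f) :
    (EN Y (2 * n) μ ↔ μ.EF Y) ∧ (EN Y (2 * n + 1) μ ↔ μ.EG Y) := by
  induction n with
  | zero => exact ⟨Iff.rfl, Iff.rfl⟩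
  | succ n ih => exact ih

lemma ext_step (hf : IsSMulRegular Q f) (μ : MF Q f) {M Y : Type} [AddCommGroup M] [Module Q M]
    [mM : Module (Q ⧸ Ideal.span {f}) M] [IsScalarTower Q (Q ⧸ Ideal.span {f}) M]
    [AddCommGroup Y] [Module Q Y]
    [mY : Module (Q ⧸ Ideal.span {f}) Y] [IsScalarTower Q (Q ⧸ Ideal.span {f}) Y]
    {K : Type} [AddCommGroup K] [Module Q K]
    [mK : Module (Q ⧸ Ideal.span {f}) K] [IsScalarTower Q (Q ⧸ Ideal.span {f}) K]
    (p : μ.G →ₗ[Q] M) (hp : Function.Surjective p) (hk : ∀ y, p y = 0 ↔ ∃ x, μ.φ x = y)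
    (p' : μ.F →ₗ[Q] K) (hp' : Function.Surjective p') (hk' : ∀ x, p' x = 0 ↔ ∃ y, μ.ψ y = x) :
    (Subsingleton (extMod (Q ⧸ Ideal.span {f}) M Y mM mY 1) ↔ μ.EF Y) ∧
    ∀ n, (Subsingleton (extMod (Q ⧸ Ideal.span {f}) M Y mM mY (n + 2)) ↔
      Subsingleton (extMod (Q ⧸ Ideal.span {f}) K Y mK mY (n + 1))) := by
  obtain ⟨ι, _, q, hq, hqk⟩ := exists_cover f μ.G
  have hqk' : ∀ y, q (f • y) = 0 := fun y => by
    rw [map_smul]; exact smul_eq_zero_of_tower (f := f) _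
  obtain ⟨pb, hpb⟩ := descend q hq p (fun y hy => by
    obtain ⟨y', rfl⟩ := hqk y hy
    rw [map_smul]; exact smul_eq_zero_of_tower (f := f) _)
  obtain ⟨i, hi⟩ := descend p' hp' (q ∘ₗ μ.φ) (fun x hx => by
    obtain ⟨y, rfl⟩ := (hk' x).1 hx
    rw [LinearMap.comp_apply, μ.φψ, hqk'])
  have hinj : Function.Injective i := by
    rw [← LinearMap.ker_eq_bot, LinearMap.ker_eq_bot']
    intro x hx
    obtain ⟨x, rfl⟩ := hp' x
    rw [hi] at hx
    obtain ⟨y, hy⟩ := hqk _ hx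
    rw [← μ.φψ] at hy
    rw [hk']
    exact ⟨y, μ.φ_inj hf hy⟩
  have hps : Function.Surjective pb := fun m => by
    obtain ⟨y, rfl⟩ := hp m
    exact ⟨q y, hpb y⟩
  have hex : Function.Exact i pb := by
    intro z
    obtain ⟨y, rfl⟩ := hq z
    rw [hpb, hk]
    constructor
    · rintro ⟨x, rfl⟩
      exact ⟨p' x, hi x⟩
    · rintro ⟨x, hx⟩
      obtain ⟨x, rfl⟩ := hp' x
      rw [hi, LinearMap.comp_apply, ← sub_eq_zero, ← map_sub] at hx
      obtain ⟨y', hy'⟩ := hqk _ hx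
      refine ⟨x - μ.ψ y', ?_⟩
      rw [map_sub, μ.φψ, hy']
      abel
  have hsurj : Function.Surjective (algebraMap Q (Q ⧸ Ideal.span {f})) :=
    Ideal.Quotient.mk_surjective
  let iA : K →ₗ[Q ⧸ Ideal.span {f}] (ι → Q ⧸ Ideal.span {f}) :=
    LinearMap.extendScalarsOfSurjective hsurj i
  let pA : (ι → Q ⧸ Ideal.span {f}) →ₗ[Q ⧸ Ideal.span {f}] M :=
    LinearMap.extendScalarsOfSurjective hsurj pb
  have hiA : Function.Injective iA := hinj
  have hpA : Function.Surjective pA := hps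
  have hexA : Function.Exact iA pA := hex
  refine ⟨(V_one iA pA hiA hpA hexA).trans ?_, fun n => V_succ iA pA hiA hpA hexA n⟩
  constructor
  · intro H u hu
    obtain ⟨u', hu'⟩ := descend p' hp' u (fun x hx => by
      obtain ⟨y, rfl⟩ := (hk' x).1 hx
      exact hu y)
    obtain ⟨v, hv⟩ := H (LinearMap.extendScalarsOfSurjective hsurj u')
    refine ⟨v.restrictScalars Q ∘ₗ q, fun x => ?_⟩
    have h1 : v (i (p' x)) = u' (p' x) := LinearMap.congr_fun hv (p' x)
    rw [hi, hu'] at h1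
    exact h1
  · intro H u
    obtain ⟨v, hv⟩ := H (u.restrictScalars Q ∘ₗ p') (fun y => by
      rw [LinearMap.comp_apply, (hk' _).2 ⟨y, rfl⟩, map_zero])
    obtain ⟨v', hv'⟩ := descend q hq v (fun y hy => by
      obtain ⟨y', rfl⟩ := hqk y hy
      rw [map_smul]; exact smul_eq_zero_of_tower (f := f) _)
    refine ⟨LinearMap.extendScalarsOfSurjective hsurj v', LinearMap.ext fun x => ?_⟩
    obtain ⟨x, rfl⟩ := hp' x
    change v' (i (p' x)) = u (p' x)
    rw [hi]
    exact (hv' (μ.φ x)).trans (hv x)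

lemma exists_cok (μ : MF Q f) : ∃ (K : Type) (_ : AddCommGroup K) (_ : Module Q K)
    (_ : Module (Q ⧸ Ideal.span {f}) K) (_ : IsScalarTower Q (Q ⧸ Ideal.span {f}) K)
    (p : μ.G →ₗ[Q] K), Function.Surjective p ∧ ∀ y, p y = 0 ↔ ∃ x, μ.φ x = y :=
  ⟨μ.Cok, inferInstance, inferInstance, μ.cokMod, μ.cokTower, (LinearMap.range μ.φ).mkQ,
    Submodule.mkQ_surjective _, fun _ => Submodule.Quotient.mk_eq_zero _⟩

lemma ext_EN (hf : IsSMulRegular Q f) {Y : Type} [AddCommGroup Y] [Module Q Y]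
    [mY : Module (Q ⧸ Ideal.span {f}) Y] [IsScalarTower Q (Q ⧸ Ideal.span {f}) Y] (n : ℕ) :
    ∀ (μ : MF Q f) {M : Type} [AddCommGroup M] [Module Q M]
    [mM : Module (Q ⧸ Ideal.span {f}) M] [IsScalarTower Q (Q ⧸ Ideal.span {f}) M]
    (p : μ.G →ₗ[Q] M) (_ : Function.Surjective p) (_ : ∀ y, p y = 0 ↔ ∃ x, μ.φ x = y),
    Subsingleton (extMod (Q ⧸ Ideal.span {f}) M Y mM mY (n + 1)) ↔ EN Y n μ := by
  induction n with
  | zero =>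
    intro μ M _ _ _ _ p hp hk
    obtain ⟨K, _, _, _, _, p', hp', hk'⟩ := μ.swap.exists_cok
    exact (μ.ext_step hf p hp hk p' hp' hk').1
  | succ n ih =>
    intro μ M _ _ _ _ p hp hk
    obtain ⟨K, _, _, _, _, p', hp', hk'⟩ := μ.swap.exists_cok
    refine ((μ.ext_step hf p hp hk p' hp' hk').2 n).trans ?_
    exact ih μ.swap p' hp' hk'

lemma extVan_iff (hf : IsSMulRegular Q f) {Y : Type} [AddCommGroup Y] [Module Q Y]
    [mY : Module (Q ⧸ Ideal.span {f}) Y] [IsScalarTower Q (Q ⧸ Ideal.span {f}) Y]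
    (μ : MF Q f) {M : Type} [AddCommGroup M] [Module Q M]
    [mM : Module (Q ⧸ Ideal.span {f}) M] [IsScalarTower Q (Q ⧸ Ideal.span {f}) M]
    (p : μ.G →ₗ[Q] M) (hp : Function.Surjective p) (hk : ∀ y, p y = 0 ↔ ∃ x, μ.φ x = y) :
    extVan (Q ⧸ Ideal.span {f}) M Y mM mY ↔ μ.E Y := by
  constructor
  · rintro ⟨n, hn⟩
    refine ⟨?_, ?_⟩
    · rw [← (EN_even Y n μ).1, ← ext_EN hf _ μ p hp hk]
      exact hn _ (by omega)
    · rw [← (EN_even Y n μ).2, ← ext_EN hf _ μ p hp hk]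
      exact hn _ (by omega)
  · intro h
    refine ⟨1, fun i hi => ?_⟩
    obtain ⟨i, rfl⟩ : ∃ j, i = j + 1 := ⟨i - 1, by omega⟩
    rw [ext_EN hf _ μ p hp hk]
    rcases Nat.even_or_odd' i with ⟨k, rfl | rfl⟩
    · exact (EN_even Y k μ).1.2 h.1
    · exact (EN_even Y k μ).2.2 h.2

variable [IsLocalRing Q] [IsNoetherianRing Q]

lemma exists_mf {M : Type} [AddCommGroup M] [Module Q M] [Module.Finite Q M]
    (hM : ∀ m : M, f • m = 0) (h : PD Q M 2) :
    ∃ (μ : MF Q f) (p : μ.G →ₗ[Q] M), Function.Surjective p ∧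
      ∀ y, p y = 0 ↔ ∃ x, μ.φ x = y := by
  obtain ⟨m, p, hp⟩ := Module.Finite.exists_fin' Q M
  have h1 : Module.Projective Q (LinearMap.ker p) :=
    PD_one_iff.1 (PD.X₁ (LinearMap.ker p).subtype p (Submodule.injective_subtype _) hp
      (LinearMap.exact_subtype_ker_map p) (PD_one_iff.2 inferInstance) h)
  have h2 : Module.Free Q (LinearMap.ker p) := Module.free_of_flat_of_isLocalRing
  let ψ : (Fin m → Q) →ₗ[Q] LinearMap.ker p :=
    LinearMap.codRestrict _ (f • LinearMap.id) (fun y => by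
      rw [LinearMap.mem_ker, LinearMap.smul_apply, map_smul, hM])
  let μ : MF Q f :=
    { F := LinearMap.ker p
      G := Fin m → Q
      φ := (LinearMap.ker p).subtype
      ψ := ψ
      φψ := fun y => rfl
      ψφ := fun y => rfl }
  refine ⟨μ, p, hp, fun y => ⟨fun hy => ⟨⟨y, hy⟩, rfl⟩, ?_⟩⟩
  rintro ⟨x, rfl⟩
  exact x.2

/-- `M` is represented stably by a reduced matrix factorization. -/
def Good (f : Q) (M : Type) [AddCommGroup M] [Module Q M]
    [mM : Module (Q ⧸ Ideal.span {f}) M] : Prop :=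
  ∃ ν : MF Q f, ν.Red ∧
    (∀ (Y : Type) [AddCommGroup Y] [Module Q Y] [mY : Module (Q ⧸ Ideal.span {f}) Y]
      [IsScalarTower Q (Q ⧸ Ideal.span {f}) Y],
      extVan (Q ⧸ Ideal.span {f}) M Y mM mY ↔ ν.E Y) ∧
    ∀ κ : MF Q f, κ.E M ↔ κ.E ν.Cok

lemma extVan_shift {A K F M Y : Type} [CommRing A] [AddCommGroup K] [AddCommGroup F]
    [AddCommGroup M] [AddCommGroup Y] [mK : Module A K] [mF : Module A F] [mM : Module A M]
    [mY : Module A Y] [Module.Projective A F] (i : K →ₗ[A] F) (p : F →ₗ[A] M)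
    (hi : Function.Injective i)
    (hp : Function.Surjective p) (hip : Function.Exact i p) :
    extVan A M Y mM mY ↔ extVan A K Y mK mY := by
  constructor
  · rintro ⟨n, hn⟩
    refine ⟨n + 1, fun j hj => ?_⟩
    obtain ⟨j, rfl⟩ : ∃ k, j = k + 1 := ⟨j - 1, by omega⟩
    exact (V_succ i p hi hp hip j).1 (hn _ (by omega))
  · rintro ⟨n, hn⟩
    refine ⟨n + 2, fun j hj => ?_⟩
    obtain ⟨j, rfl⟩ : ∃ k, j = k + 2 := ⟨j - 2, by omega⟩
    exact (V_succ i p hi hp hip j).2 (hn _ (by omega))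

lemma good (hf : IsSMulRegular Q f) (n : ℕ) : ∀ (M : Type) [AddCommGroup M] [Module Q M]
    [Module (Q ⧸ Ideal.span {f}) M] [IsScalarTower Q (Q ⧸ Ideal.span {f}) M]
    [Module.Finite Q M] (_ : PD Q M (n + 2)), Good f M := by
  induction n with
  | zero =>
    intro M _ _ _ _ _ h
    obtain ⟨μ, p, hp, hk⟩ := exists_mf (f := f) (smul_eq_zero_of_tower (f := f)) h
    obtain ⟨ν, hν, hr⟩ := exists_red hf _ μ le_rfl
    refine ⟨ν, hν, fun Y _ _ _ _ => ?_, fun κ => ?_⟩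
    · rw [μ.extVan_iff hf p hp hk, E, E, hr.ef, hr.eg]
    · rw [← hr.c]
      have : LinearMap.range μ.φ = LinearMap.ker p := by
        ext y
        rw [LinearMap.mem_ker, hk]
        rfl
      exact (κ.E_congr ((Submodule.quotEquivOfEq _ _ this).trans
        (p.quotKerEquivOfSurjective hp))).symm
  | succ n ih =>
    intro M _ _ _ _ _ h
    have : Module.Finite (Q ⧸ Ideal.span {f}) M := Module.Finite.of_restrictScalars_finite Q _ M
    obtain ⟨m, p, hp⟩ := Module.Finite.exists_fin' (Q ⧸ Ideal.span {f}) M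
    have hfin : Module.Finite Q (LinearMap.ker p) :=
      Module.Finite.of_injective ((LinearMap.ker p).subtype.restrictScalars Q)
        (Submodule.injective_subtype _)
    let π : (Fin m → Q) →ₗ[Q] (Fin m → Q ⧸ Ideal.span {f}) :=
      LinearMap.pi fun i => (Submodule.mkQ (Ideal.span {f})) ∘ₗ LinearMap.proj i
    have hπ : Function.Surjective π := by
      intro z
      choose w hw using fun i => Submodule.mkQ_surjective (Ideal.span {f}) (z i)
      exact ⟨w, funext hw⟩
    have hπk : ∀ y, π y = 0 → ∃ y', f • y' = y := by
      intro y hy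
      have : ∀ i, ∃ a, f * a = y i := fun i => by
        have h1 : (Submodule.Quotient.mk (y i) : Q ⧸ Ideal.span {f}) = 0 := congrFun hy i
        rw [Submodule.Quotient.mk_eq_zero, Ideal.mem_span_singleton'] at h1
        obtain ⟨a, ha⟩ := h1
        exact ⟨a, by rw [mul_comm, ha]⟩
      choose a ha using this
      exact ⟨a, funext ha⟩
    have hreg : IsSMulRegular (Fin m → Q) f := regular_of_free hf
    have hpd : PD Q (Fin m → Q ⧸ Ideal.span {f}) 2 := by
      refine PD.X₃ (n := 1) (LinearMap.lsmul Q (Fin m → Q) f) π hreg hπ ?_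
        (PD_one_iff.2 inferInstance) ((PD_one_iff.2 inferInstance).mono one_le_two)
      intro y
      refine ⟨hπk y, ?_⟩
      rintro ⟨y, rfl⟩
      rw [LinearMap.lsmul_apply, map_smul]
      exact smul_eq_zero_of_tower (f := f) _
    have hK : PD Q (LinearMap.ker p) (n + 2) :=
      PD.X₁ ((LinearMap.ker p).subtype.restrictScalars Q) (p.restrictScalars Q)
        (Submodule.injective_subtype _) hp (LinearMap.exact_subtype_ker_map p)
        (hpd.mono (by omega)) h
    obtain ⟨ν, h1, h2, h3⟩ := ih (LinearMap.ker p) hK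
    refine ⟨ν, h1, fun Y _ _ _ _ => ?_, fun κ => ?_⟩
    · rw [← h2]
      exact extVan_shift (LinearMap.ker p).subtype p (Submodule.injective_subtype _) hp
        (LinearMap.exact_subtype_ker_map p)
    · rw [← h3]
      exact (κ.E_X₁_iff_X₃ ((LinearMap.ker p).subtype.restrictScalars Q) (p.restrictScalars Q)
        (Submodule.injective_subtype _) hp (LinearMap.exact_subtype_ker_map p)
        (smul_eq_zero_of_tower (f := f)) (κ.E_free π hπ hπk hreg)).symm

lemma E_of_left (κ : MF Q f) (hf : IsSMulRegular Q f) (h : Module.finrank Q κ.F = 0) (Y : Type)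
    [AddCommGroup Y] [Module Q Y] : κ.E Y := by
  have h' := h
  rw [κ.finrank_eq hf] at h'
  rw [Module.finrank_eq_zero_iff_of_free] at h h'
  refine ⟨fun u hu => ⟨0, fun x => ?_⟩, fun u hu => ⟨0, fun x => ?_⟩⟩
  · rw [Subsingleton.elim x 0, map_zero, map_zero, map_zero]
  · rw [Subsingleton.elim x 0, map_zero, map_zero, map_zero]

lemma E_of_right (κ μ : MF Q f) (hf : IsSMulRegular Q f) (h : Module.finrank Q μ.F = 0) :
    κ.E μ.Cok := by
  rw [μ.finrank_eq hf, Module.finrank_eq_zero_iff_of_free] at h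
  have : Subsingleton μ.Cok := inferInstance
  exact ⟨fun u hu => ⟨0, fun x => Subsingleton.elim _ _⟩,
    fun u hu => ⟨0, fun x => Subsingleton.elim _ _⟩⟩

lemma E_residue (ν : MF Q f) (hf : IsSMulRegular Q f) (hν : ν.Red) :
    ν.E (Q ⧸ maximalIdeal Q) ↔ Module.finrank Q ν.F = 0 := by
  refine ⟨fun h => ?_, fun h => ν.E_of_left hf h _⟩
  by_contra hne
  have hz : ∀ {P : Type} [AddCommGroup P] [Module Q P] (u : P →ₗ[Q] Q ⧸ maximalIdeal Q) (x : P),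
      x ∈ maximalIdeal Q • (⊤ : Submodule Q P) → u x = 0 := by
    intro P _ _ u x hx
    have := map_mem_smul _ u hx
    refine Submodule.smul_induction_on this (fun r hr n _ => ?_) (fun a b ha hb => ?_)
    · exact @quot_isTorsionBySet Q _ (maximalIdeal Q) n ⟨r, hr⟩
    · rw [ha, hb, add_zero]
  let b := Module.Free.chooseBasis Q ν.F
  have : Nonempty (Module.Free.ChooseBasisIndex Q ν.F) := by
    by_contra hemp
    rw [not_nonempty_iff] at hemp
    exact hne (by rw [Module.finrank_eq_card_basis b, Fintype.card_eq_zero])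
  obtain ⟨i⟩ := this
  obtain ⟨v, hv⟩ := h.1 ((maximalIdeal Q).mkQ ∘ₗ b.coord i) (fun y => hz _ _ (hν.2 y))
  have h1 := hv (b i)
  rw [hz v _ (hν.1 _), LinearMap.comp_apply, Module.Basis.coord_apply, Module.Basis.repr_self,
    Finsupp.single_eq_same] at h1
  have h2 := (Submodule.Quotient.mk_eq_zero _).1 h1.symm
  exact (Ideal.ne_top_iff_one _).1 (maximalIdeal.isMaximal Q).ne_top h2

lemma extInf_iff (A : Type) [CommRing A] (M N : Type) [AddCommGroup M] [AddCommGroup N]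
    (mM : Module A M) (mN : Module A N) : extInf A M N mM mN ↔ ¬ extVan A M N mM mN := by
  unfold extInf extVan
  push Not
  simp only [not_subsingleton_iff_nontrivial]

theorem main (hQ : IsRegularLocal Q) (hf : IsSMulRegular Q f) (M N : Type) [AddCommGroup M]
    [AddCommGroup N] [Module Q M] [Module Q N] [Module.Finite Q M] [Module.Finite Q N]
    (mM : Module (Q ⧸ Ideal.span {f}) M) (mN : Module (Q ⧸ Ideal.span {f}) N)
    (mk : Module (Q ⧸ Ideal.span {f}) (Q ⧸ maximalIdeal Q))
    (_ : IsScalarTower Q (Q ⧸ Ideal.span {f}) M) (_ : IsScalarTower Q (Q ⧸ Ideal.span {f}) N)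
    (_ : IsScalarTower Q (Q ⧸ Ideal.span {f}) (Q ⧸ maximalIdeal Q)) :
    extInf (Q ⧸ Ideal.span {f}) M N mM mN ↔
      (extInf (Q ⧸ Ideal.span {f}) M (Q ⧸ maximalIdeal Q) mM mk ∧
        extInf (Q ⧸ Ideal.span {f}) N (Q ⧸ maximalIdeal Q) mN mk) := by
  obtain ⟨n, hn⟩ := exists_PD hQ
  obtain ⟨ν, h1, h2, h3⟩ := good hf n M ((hn M).mono (by omega))
  obtain ⟨ρ, k1, k2, k3⟩ := good hf n N ((hn N).mono (by omega))
  rw [extInf_iff, extInf_iff, extInf_iff, ← not_or, not_iff_not, h2, h2, k2, k3,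
    E_residue ν hf h1, E_residue ρ hf k1]
  constructor
  · exact key ν ρ h1 k1 hf n hn
  · rintro (h | h)
    · exact ν.E_of_left hf h _
    · exact E_of_right ν ρ hf h

end ext

end MF

theorem statement5
    (Q : Type) [CommRing Q] [IsLocalRing Q] [IsNoetherianRing Q]
    (hQreg : IsRegularLocal Q)
    (c : ℕ) (hc : 1 ≤ c) (f : Fin c → Q)
    (hfreg : RingTheory.Sequence.IsRegular Q (List.ofFn f))
    (I : Ideal Q) (hIf : I = Ideal.span (Set.range f))
    (hIsq : I ≤ maximalIdeal Q ^ 2)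
    (M N : Type) [AddCommGroup M] [AddCommGroup N] [Module Q M] [Module Q N]
    [Module.Finite Q M] [Module.Finite Q N]
    (hM : Module.IsTorsionBySet Q M (I : Set Q))
    (hN : Module.IsTorsionBySet Q N (I : Set Q))
    (f₀ : Q) (hf₀ : f₀ ∈ I) (hf₀ne : f₀ ∉ maximalIdeal Q * I) :
    extInf (Q ⧸ Ideal.span {f₀}) M N
        (modOver (Ideal.span {f₀}) ((Ideal.span_singleton_le_iff_mem I).mpr hf₀) M hM)
        (modOver (Ideal.span {f₀}) ((Ideal.span_singleton_le_iff_mem I).mpr hf₀) N hN) ↔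
      (extInf (Q ⧸ Ideal.span {f₀}) M (Q ⧸ maximalIdeal Q)
          (modOver (Ideal.span {f₀}) ((Ideal.span_singleton_le_iff_mem I).mpr hf₀) M hM)
          (kMod (Ideal.span {f₀}) (((Ideal.span_singleton_le_iff_mem I).mpr hf₀).trans
            (hIsq.trans (Ideal.pow_le_self two_ne_zero)))) ∧
        extInf (Q ⧸ Ideal.span {f₀}) N (Q ⧸ maximalIdeal Q)
          (modOver (Ideal.span {f₀}) ((Ideal.span_singleton_le_iff_mem I).mpr hf₀) N hN)
          (kMod (Ideal.span {f₀}) (((Ideal.span_singleton_le_iff_mem I).mpr hf₀).trans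
            (hIsq.trans (Ideal.pow_le_self two_ne_zero))))) := by
  have hIm : I ≤ maximalIdeal Q := hIsq.trans (Ideal.pow_le_self two_ne_zero)
  have hI : Ideal.ofList (List.ofFn f) = I := by
    rw [hIf, Ideal.ofList]
    congr 1
    ext x
    simp [List.mem_ofFn]
  have hreg : IsSMulRegular Q f₀ := by
    refine regular_of_mem (List.ofFn f) hfreg.toIsWeaklyRegular (fun r hr => ?_) f₀
      (hI.symm ▸ hf₀) (hI.symm ▸ hf₀ne)
    apply hIm
    rw [← hI]
    exact Ideal.subset_span hr
  exact MF.main hQreg hreg M N _ _ _ (Module.IsTorsionBySet.isScalarTower _)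
    (Module.IsTorsionBySet.isScalarTower _) (Module.IsTorsionBySet.isScalarTower _)
end
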